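/- arXiv:2102.09074 — 10 statements merged into one kernel-verified Lean document; each statement's English description precedes it below -/
import Mathlib

section
/- Let O : Matrix ι₂ ι₁ ℂ be a matrix such that (i) for every parity-preserving A : Matrix ι₁ ι₁ ℂ, the matrix O * A * Oᴴ is parity-preserving on ι₂, and (ii) for every parity-preserving B : Matrix ι₂ ι₂ ℂ, the matrix Oᴴ * B * O is parity-preserving on ι₁. Then S₂ * O * S₁ = O or S₂ * O * S₁ = −O, i.e. O is block-diagonal or block-anti-diagonal with respect to the two parity decompositions. -/
open scoped Matrix

/-- The parity matrix on `α ⊕ β`: diagonal with `+1` on `α` and `-1` on `β`. -/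
noncomputable def parityMatrix (α β : Type*) [DecidableEq α] [DecidableEq β] :
    Matrix (α ⊕ β) (α ⊕ β) ℂ :=
  Matrix.diagonal (Sum.elim (fun _ => (1 : ℂ)) (fun _ => (-1 : ℂ)))

/-- The parity sign: `+1` on `α` and `-1` on `β`. -/
noncomputable def paritySign {α β : Type*} : α ⊕ β → ℂ :=
  Sum.elim (fun _ => 1) (fun _ => -1)

lemma paritySign_eq_one_or_neg_one {α β : Type*} (i : α ⊕ β) :
    paritySign i = 1 ∨ paritySign i = -1 := by
  cases i <;> simp [paritySign]

section

variable {α₁ β₁ α₂ β₂ : Type*} [Fintype α₁] [Fintype β₁] [Fintype α₂] [Fintype β₂]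
  [DecidableEq α₁] [DecidableEq β₁] [DecidableEq α₂] [DecidableEq β₂]

lemma parityMatrix_mul_mul_parityMatrix_apply (M : Matrix (α₂ ⊕ β₂) (α₁ ⊕ β₁) ℂ)
    (i : α₂ ⊕ β₂) (j : α₁ ⊕ β₁) :
    (parityMatrix α₂ β₂ * M * parityMatrix α₁ β₁) i j =
      paritySign i * M i j * paritySign j := by
  simp only [parityMatrix, Matrix.mul_diagonal, Matrix.diagonal_mul, paritySign]

/-- If `A ↦ O * A * Oᴴ` maps parity-preserving matrices to parity-preserving matrices, then two
entries of `O` in columns of equal parity and rows of opposite parity cannot both be nonzero. -/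
lemma eq_zero_or_eq_zero_of_conj_preserves_parity (O : Matrix (α₂ ⊕ β₂) (α₁ ⊕ β₁) ℂ)
    (h : ∀ A : Matrix (α₁ ⊕ β₁) (α₁ ⊕ β₁) ℂ,
      parityMatrix α₁ β₁ * A * parityMatrix α₁ β₁ = A →
      parityMatrix α₂ β₂ * (O * A * Oᴴ) * parityMatrix α₂ β₂ = O * A * Oᴴ)
    {i i' : α₂ ⊕ β₂} {j j' : α₁ ⊕ β₁} (hj : paritySign j = paritySign j')
    (hi : paritySign i = -paritySign i') : O i j = 0 ∨ O i' j' = 0 := by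
  have hA : parityMatrix α₁ β₁ * Matrix.single j j' 1 * parityMatrix α₁ β₁ =
      Matrix.single j j' 1 := by
    ext k l
    rw [parityMatrix_mul_mul_parityMatrix_apply]
    by_cases hkl : j = k ∧ j' = l
    · obtain ⟨rfl, rfl⟩ := hkl
      rcases paritySign_eq_one_or_neg_one j' with h' | h' <;> simp [hj, h']
    · simp [Matrix.single_apply_of_ne (h := hkl)]
  have hentry : (O * Matrix.single j j' (1 : ℂ) * Oᴴ) i i' = O i j * star (O i' j') := by
    rw [Matrix.mul_apply, Finset.sum_eq_single j']
    · simp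
    · intro l _ hl
      simp [hl]
    · simp
  have key := congrFun (congrFun (h _ hA) i) i'
  rw [parityMatrix_mul_mul_parityMatrix_apply, hentry, hi] at key
  have hzero : O i j * star (O i' j') = 0 := by
    rcases paritySign_eq_one_or_neg_one i' with h' | h' <;> rw [h'] at key <;>
      linear_combination (-1 / 2) * key
  simpa using hzero

end

/-- A linear (rectangular) operator which conjugates parity-preserving matrices to
parity-preserving matrices in both directions is block-diagonal or block-anti-diagonal. -/
theorem blockForm_of_preserves_parity
    {α₁ β₁ α₂ β₂ : Type*} [Fintype α₁] [Fintype β₁] [Fintype α₂] [Fintype β₂]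
    [DecidableEq α₁] [DecidableEq β₁] [DecidableEq α₂] [DecidableEq β₂]
    (O : Matrix (α₂ ⊕ β₂) (α₁ ⊕ β₁) ℂ)
    (h₁ : ∀ A : Matrix (α₁ ⊕ β₁) (α₁ ⊕ β₁) ℂ,
      parityMatrix α₁ β₁ * A * parityMatrix α₁ β₁ = A →
      parityMatrix α₂ β₂ * (O * A * Oᴴ) * parityMatrix α₂ β₂ = O * A * Oᴴ)
    (h₂ : ∀ B : Matrix (α₂ ⊕ β₂) (α₂ ⊕ β₂) ℂ,
      parityMatrix α₂ β₂ * B * parityMatrix α₂ β₂ = B →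
      parityMatrix α₁ β₁ * (Oᴴ * B * O) * parityMatrix α₁ β₁ = Oᴴ * B * O) :
    parityMatrix α₂ β₂ * O * parityMatrix α₁ β₁ = O ∨
      parityMatrix α₂ β₂ * O * parityMatrix α₁ β₁ = -O := by
  have row {i i' j j'} := eq_zero_or_eq_zero_of_conj_preserves_parity O h₁
    (i := i) (i' := i') (j := j) (j' := j')
  have col {i i' j j'} (hi : paritySign i = paritySign i')
      (hj : paritySign j = -paritySign j') : O i j = 0 ∨ O i' j' = 0 := by
    simpa using eq_zero_or_eq_zero_of_conj_preserves_parity Oᴴ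
      (by simpa only [Matrix.conjTranspose_conjTranspose] using h₂) hi hj
  by_cases hO : ∀ i j, paritySign i = -paritySign j → O i j = 0
  · left
    ext i j
    rw [parityMatrix_mul_mul_parityMatrix_apply]
    have := hO i j
    rcases paritySign_eq_one_or_neg_one i with hi | hi <;>
      rcases paritySign_eq_one_or_neg_one j with hj | hj <;> simp_all
  · right
    push Not at hO
    obtain ⟨i, j, hij, hne⟩ := hO
    ext i' j'
    rw [parityMatrix_mul_mul_parityMatrix_apply, Matrix.neg_apply]
    have hr := row (i := i) (i' := i') (j := j) (j' := j')
    have hc := col (i := i) (i' := i') (j := j) (j' := j')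
    simp only [hne, false_or, hij] at hr hc
    have hzero (hij' : paritySign i' = paritySign j') : O i' j' = 0 := by
      rw [hij'] at hr hc
      rcases paritySign_eq_one_or_neg_one j with hj | hj <;>
        rcases paritySign_eq_one_or_neg_one j' with hj' | hj' <;>
        rw [hj, hj'] at hr hc <;> first | exact hr rfl rfl | exact hc (by simp) (by simp)
    rcases paritySign_eq_one_or_neg_one i' with hi' | hi' <;>
      rcases paritySign_eq_one_or_neg_one j' with hj' | hj' <;>
      rw [hi', hj'] at hzero ⊢ <;> simp [hzero]
end

section
/- A matrix P : Matrix ι ι ℂ is Hermitian, idempotent (P * P = P), and parity-preserving if and only if there exist n : ℕ and a family v : Fin n → (ι → ℂ) of vectors that is orthonormal with respect to the standard Hermitian inner product (∑ x, conj (v i x) * v j x = if i = j then 1 else 0), each v i being a parity eigenvector, such that P x y = ∑ i, v i x * conj (v i y) for all x y. -/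
open scoped Matrix ComplexConjugate

namespace Matrix

/-- A Hermitian idempotent matrix is `V * Vᴴ` for some `V` with orthonormal columns. -/
theorem IsHermitian.exists_eq_mul_conjTranspose_of_isIdempotentElem {ι : Type*} [Fintype ι]
    [DecidableEq ι] {A : Matrix ι ι ℂ} (hA : A.IsHermitian) (hA2 : IsIdempotentElem A) :
    ∃ (n : ℕ) (V : Matrix ι (Fin n) ℂ), Vᴴ * V = 1 ∧ A = V * Vᴴ := by
  have hev (k : ι) : hA.eigenvalues k = 0 ∨ hA.eigenvalues k = 1 := by
    simpa using hA2.spectrum_subset ℝ (hA.eigenvalues_mem_spectrum_real k)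
  let e := (Fintype.equivFin {k // hA.eigenvalues k = 1}).symm
  let U : Matrix ι ι ℂ := hA.eigenvectorUnitary
  refine ⟨_, U.submatrix id fun i => (e i : ι), ?_, ?_⟩
  · have hU : Uᴴ * U = 1 := Unitary.coe_star_mul_self hA.eigenvectorUnitary
    rw [conjTranspose_submatrix, ← submatrix_mul _ _ _ id _ Function.bijective_id, hU]
    exact submatrix_one _ (Subtype.val_injective.comp e.injective)
  · have hs : A = U * diagonal (RCLike.ofReal ∘ hA.eigenvalues) * Uᴴ := hA.spectral_theorem
    ext x y
    calc A x y = ∑ k, U x k * hA.eigenvalues k * star (U y k) := by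
          simpa [mul_apply (M := U * _), mul_diagonal] using congr_fun₂ hs x y
      _ = ∑ k with hA.eigenvalues k = 1, U x k * star (U y k) := by
          rw [Finset.sum_filter]
          refine Finset.sum_congr rfl fun k _ => ?_
          rcases hev k with hk | hk <;> simp [hk]
      _ = ∑ k : {k // hA.eigenvalues k = 1}, U x k * star (U y k) :=
          Finset.sum_subtype _ (by simp) _
      _ = _ := (e.sum_comp fun k => U x k * star (U y k)).symm

/-- A parity-preserving matrix is block diagonal. -/
theorem eq_fromBlocks_of_parityMatrix_mul_mul {α β : Type*} [Fintype α] [Fintype β]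
    [DecidableEq α] [DecidableEq β] {P : Matrix (α ⊕ β) (α ⊕ β) ℂ}
    (h : parityMatrix α β * P * parityMatrix α β = P) :
    P = fromBlocks P.toBlocks₁₁ 0 0 P.toBlocks₂₂ := by
  have hP (x y) := congr_fun₂ h x y
  simp only [parityMatrix, mul_diagonal, diagonal_mul] at hP
  ext (a | b) (a' | b')
  · rfl
  · simpa [neg_eq_self] using hP (.inl a) (.inr b')
  · simpa [neg_eq_self] using hP (.inr b) (.inl a')
  · rfl

end Matrix

/-- A matrix is a Hermitian, idempotent, parity-preserving projector iff it is a sum of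
rank-one projections onto an orthonormal family of parity eigenvectors. -/
theorem parity_projector_iff_sum_rank_one
    {α β : Type*} [Fintype α] [Fintype β] [DecidableEq α] [DecidableEq β]
    (P : Matrix (α ⊕ β) (α ⊕ β) ℂ) :
    (Pᴴ = P ∧ P * P = P ∧ parityMatrix α β * P * parityMatrix α β = P) ↔
      ∃ (n : ℕ) (v : Fin n → ((α ⊕ β) → ℂ)),
        (∀ i j, ∑ x, conj (v i x) * v j x = if i = j then 1 else 0) ∧
        (∀ i, (parityMatrix α β).mulVec (v i) = v i ∨
          (parityMatrix α β).mulVec (v i) = -(v i)) ∧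
        (∀ x y, P x y = ∑ i, v i x * conj (v i y)) := by
  constructor
  · rintro ⟨hP, hP2, hS⟩
    have hB := Matrix.eq_fromBlocks_of_parityMatrix_mul_mul hS
    generalize P.toBlocks₁₁ = A, P.toBlocks₂₂ = D at hB
    subst hB
    rw [Matrix.fromBlocks_conjTranspose, Matrix.fromBlocks_inj] at hP
    rw [Matrix.fromBlocks_multiply, Matrix.fromBlocks_inj] at hP2
    simp only [Matrix.mul_zero, Matrix.zero_mul, add_zero, zero_add] at hP2
    obtain ⟨n, V, hV, rfl⟩ :=
      Matrix.IsHermitian.exists_eq_mul_conjTranspose_of_isIdempotentElem hP.1 hP2.1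
    obtain ⟨m, W, hW, rfl⟩ :=
      Matrix.IsHermitian.exists_eq_mul_conjTranspose_of_isIdempotentElem hP.2.2.2 hP2.2.2.2
    have hV' (i j) : ∑ x, conj (V x i) * V x j = if i = j then 1 else 0 := by
      simpa [Matrix.mul_apply, Matrix.one_apply] using congr_fun₂ hV i j
    have hW' (i j) : ∑ x, conj (W x i) * W x j = if i = j then 1 else 0 := by
      simpa [Matrix.mul_apply, Matrix.one_apply] using congr_fun₂ hW i j
    refine ⟨n + m, Fin.append (fun i => Sum.elim (V.col i) 0) (fun j => Sum.elim 0 (W.col j)),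
      ?_, ?_, ?_⟩
    · intro i j
      cases i using Fin.addCases <;> cases j using Fin.addCases <;>
        simp [hV', hW', Fin.ext_iff] <;> omega
    · intro i
      cases i using Fin.addCases
      · left
        ext (a | b) <;> simp [parityMatrix, Matrix.mulVec_diagonal]
      · right
        ext (a | b) <;> simp [parityMatrix, Matrix.mulVec_diagonal]
    · rintro (a | b) (a' | b') <;> simp [Fin.sum_univ_add, Matrix.mul_apply]
  · rintro ⟨n, v, hv, hS, hP⟩
    let V : Matrix (α ⊕ β) (Fin n) ℂ := Matrix.of fun x i => v i x
    have hV : Vᴴ * V = 1 := by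
      ext i j
      simpa [Matrix.mul_apply, Matrix.one_apply, V] using hv i j
    obtain rfl : P = V * Vᴴ := by
      ext x y
      simpa [Matrix.mul_apply, V] using hP x y
    refine ⟨by simp, ?_, ?_⟩
    · rw [Matrix.mul_assoc, ← Matrix.mul_assoc Vᴴ, hV, Matrix.one_mul]
    · have hstar (x : α ⊕ β) : conj (Sum.elim (fun _ => (1 : ℂ)) (fun _ => -1) x) =
          Sum.elim (fun _ => (1 : ℂ)) (fun _ => -1) x := by
        cases x <;> simp
      simp only [parityMatrix] at hS ⊢
      generalize Sum.elim (fun _ : α => (1 : ℂ)) (fun _ : β => -1) = σ at hS hstar ⊢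
      ext x y
      rw [Matrix.mul_diagonal, Matrix.diagonal_mul, Matrix.mul_apply, Finset.mul_sum,
        Finset.sum_mul]
      refine Finset.sum_congr rfl fun i _ => ?_
      change σ x * (v i x * conj (v i y)) * σ y = v i x * conj (v i y)
      rcases hS i with h | h <;> have hx := congr_fun h x <;>
        have hy := congrArg conj (congr_fun h y) <;>
        simp only [Matrix.mulVec_diagonal, Pi.neg_apply, map_mul, map_neg, hstar] at hx hy
      · linear_combination conj (v i y) * hx + σ x * v i x * hy
      · linear_combination -conj (v i y) * hx + σ x * v i x * hy
end

section
/- A matrix ρ : Matrix ι ι ℂ is positive semidefinite, has trace 1, and is parity-preserving if and only if there exist n : ℕ, a function p : Fin n → ℝ with 0 ≤ p i for all i and ∑ i, p i = 1, and a family v : Fin n → (ι → ℂ) of vectors, orthonormal with respect to the standard Hermitian inner product, each v i being a parity eigenvector, such that ρ x y = ∑ i, (p i : ℂ) * v i x * conj (v i y) for all x y. -/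
open scoped Matrix ComplexConjugate ComplexOrder

/-- Spectral decomposition of a positive semidefinite matrix into orthonormal rank-one terms. -/
theorem Matrix.PosSemidef.exists_orthonormal_decomposition {κ : Type*} [Fintype κ]
    [DecidableEq κ] {A : Matrix κ κ ℂ} (hA : A.PosSemidef) :
    ∃ (p : κ → ℝ) (v : κ → κ → ℂ), (∀ i, 0 ≤ p i) ∧
      (∀ i j, ∑ x, conj (v i x) * v j x = if i = j then 1 else 0) ∧
      ∀ x y, A x y = ∑ i, (p i : ℂ) * v i x * conj (v i y) := by
  have hU : star (hA.1.eigenvectorUnitary : Matrix κ κ ℂ) * hA.1.eigenvectorUnitary = 1 :=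
    Unitary.coe_star_mul_self _
  refine ⟨hA.1.eigenvalues, fun i x => (hA.1.eigenvectorUnitary : Matrix κ κ ℂ) x i,
    hA.eigenvalues_nonneg, fun i j => ?_, fun x y => ?_⟩
  · simpa [Matrix.mul_apply, Matrix.star_apply, Matrix.one_apply] using congr_fun₂ hU i j
  · have h := congr_fun₂ hA.1.spectral_theorem x y
    rw [Unitary.conjStarAlgAut_apply, Matrix.mul_apply] at h
    rw [h]
    refine Finset.sum_congr rfl fun i _ => ?_
    simp only [Matrix.mul_diagonal, Matrix.star_apply, Function.comp_apply]
    rw [mul_comm (hA.1.eigenvalues i : ℂ)]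
    rfl

theorem parityMatrix_conj_apply {α β : Type*} [Fintype α] [Fintype β] [DecidableEq α]
    [DecidableEq β] (ρ : Matrix (α ⊕ β) (α ⊕ β) ℂ) (x y : α ⊕ β) :
    (parityMatrix α β * ρ * parityMatrix α β) x y =
      Sum.elim (fun _ => (1 : ℂ)) (fun _ => -1) x * ρ x y *
        Sum.elim (fun _ => (1 : ℂ)) (fun _ => -1) y := by
  simp only [parityMatrix, Matrix.mul_diagonal, Matrix.diagonal_mul]

theorem Matrix.trace_eq_sum_of_orthonormal_decomposition {κ η : Type*} [Fintype κ] [Fintype η]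
    {A : Matrix κ κ ℂ} {p : η → ℝ} {v : η → κ → ℂ}
    (hv : ∀ i, ∑ x, conj (v i x) * v i x = 1)
    (hA : ∀ x y, A x y = ∑ i, (p i : ℂ) * v i x * conj (v i y)) :
    A.trace = ((∑ i, p i : ℝ) : ℂ) := by
  simp only [Matrix.trace, Matrix.diag_apply, hA]
  rw [Finset.sum_comm, Complex.ofReal_sum]
  refine Finset.sum_congr rfl fun i _ => ?_
  simp_rw [mul_assoc, ← Finset.mul_sum, mul_comm (v i _), hv, mul_one]

/-- A matrix is a parity-preserving density matrix (positive semidefinite, trace one)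
iff it is a convex mixture of rank-one projections onto an orthonormal family of parity
eigenvectors. -/
theorem parity_density_iff_mixture
    {α β : Type*} [Fintype α] [Fintype β] [DecidableEq α] [DecidableEq β]
    (ρ : Matrix (α ⊕ β) (α ⊕ β) ℂ) :
    (ρ.PosSemidef ∧ ρ.trace = 1 ∧ parityMatrix α β * ρ * parityMatrix α β = ρ) ↔
      ∃ (n : ℕ) (p : Fin n → ℝ) (v : Fin n → ((α ⊕ β) → ℂ)),
        (∀ i, 0 ≤ p i) ∧ (∑ i, p i = 1) ∧
        (∀ i j, ∑ x, conj (v i x) * v j x = if i = j then 1 else 0) ∧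
        (∀ i, (parityMatrix α β).mulVec (v i) = v i ∨
          (parityMatrix α β).mulVec (v i) = -(v i)) ∧
        (∀ x y, ρ x y = ∑ i, (p i : ℂ) * v i x * conj (v i y)) := by
  constructor
  · rintro ⟨hρ, htr, hpar⟩
    obtain ⟨p, v, hp, hv, hA⟩ := (hρ.submatrix Sum.inl).exists_orthonormal_decomposition
    obtain ⟨q, w, hq, hw, hD⟩ := (hρ.submatrix Sum.inr).exists_orthonormal_decomposition
    have hAD (a : α) (b : β) : ρ (Sum.inl a) (Sum.inr b) = 0 := by
      have h := congr_fun₂ hpar (Sum.inl a) (Sum.inr b)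
      rw [parityMatrix_conj_apply] at h
      simpa [neg_eq_self] using h
    have hDA (a : α) (b : β) : ρ (Sum.inr b) (Sum.inl a) = 0 := by
      have h := congr_fun₂ hpar (Sum.inr b) (Sum.inl a)
      rw [parityMatrix_conj_apply] at h
      simpa [neg_eq_self] using h
    let e := (Fintype.equivFin (α ⊕ β)).symm
    let r : α ⊕ β → ℝ := Sum.elim p q
    let u : α ⊕ β → α ⊕ β → ℂ :=
      Sum.elim (fun i => Sum.elim (v i) 0) (fun i => Sum.elim 0 (w i))
    have hu (i j : α ⊕ β) : ∑ x, conj (u i x) * u j x = if i = j then 1 else 0 := by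
      rcases i with i | i <;> rcases j with j | j <;> simp [u, hv, hw]
    have hdec (x y : α ⊕ β) : ρ x y = ∑ i, (r i : ℂ) * u i x * conj (u i y) := by
      rcases x with x | x <;> rcases y with y | y
      · simpa [r, u] using hA x y
      · simp [r, u, hAD]
      · simp [r, u, hDA]
      · simpa [r, u] using hD x y
    refine ⟨_, r ∘ e, u ∘ e, fun i => ?_, ?_, fun i j => ?_, fun i => ?_, fun x y => ?_⟩
    · rcases h : e i with a | b <;> simp [r, h, hp, hq]
    · rw [Matrix.trace_eq_sum_of_orthonormal_decomposition (fun i => by simp [hu]) hdec] at htr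
      exact (e.sum_comp r).trans (by exact_mod_cast htr)
    · simpa using hu (e i) (e j)
    · rcases h : e i with a | b
      · left
        ext x
        rcases x with x | x <;> simp [parityMatrix, Matrix.mulVec_diagonal, u, h]
      · right
        ext x
        rcases x with x | x <;> simp [parityMatrix, Matrix.mulVec_diagonal, u, h]
    · rw [hdec, ← e.sum_comp]
      rfl
  · rintro ⟨n, p, v, hp, hsum, hv, hpar, hρ⟩
    have hρ' : ρ = ∑ i, p i • Matrix.vecMulVec (v i) (star (v i)) := by
      ext x y
      simp [hρ, Matrix.sum_apply, Matrix.vecMulVec_apply, mul_assoc]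
    refine ⟨?_, ?_, ?_⟩
    · rw [hρ']
      exact Matrix.posSemidef_sum _ fun i _ =>
        (Matrix.posSemidef_vecMulVec_self_star (v i)).smul (hp i)
    · rw [Matrix.trace_eq_sum_of_orthonormal_decomposition (fun i => by simp [hv]) hρ, hsum,
        Complex.ofReal_one]
    · ext x y
      rw [parityMatrix_conj_apply, hρ, Finset.mul_sum, Finset.sum_mul]
      refine Finset.sum_congr rfl fun i _ => ?_
      rcases hpar i with h | h <;> have hx := congr_fun h x <;> have hy := congr_fun h y <;>
        rcases x with x | x <;> rcases y with y | y <;>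
        simp_all [parityMatrix, Matrix.mulVec_diagonal, neg_eq_self, self_eq_neg]
end

section
/- A matrix A : Matrix ι ι ℂ is Hermitian and parity-preserving if and only if there exist real numbers a : ι → ℝ and a family v : ι → (ι → ℂ) that is an orthonormal basis with respect to the standard Hermitian inner product (i.e. ∑ x, conj (v i x) * v j x = if i = j then 1 else 0), each v i being a parity eigenvector, such that A x y = ∑ i, (a i : ℂ) * v i x * conj (v i y) for all x y. -/
open scoped Matrix ComplexConjugate

/-- Entrywise form of the spectral theorem for Hermitian matrices. -/
theorem Matrix.IsHermitian.exists_orthonormal_expansion {n : Type*} [Fintype n] [DecidableEq n]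
    {M : Matrix n n ℂ} (hM : M.IsHermitian) :
    ∃ (a : n → ℝ) (v : n → n → ℂ),
      (∀ i j, ∑ x, conj (v i x) * v j x = if i = j then 1 else 0) ∧
      (∀ x y, M x y = ∑ i, (a i : ℂ) * v i x * conj (v i y)) := by
  refine ⟨hM.eigenvalues, fun i x => (hM.eigenvectorUnitary : Matrix n n ℂ) x i, ?_, ?_⟩
  · intro i j
    have h := congrFun (congrFun (Unitary.coe_star_mul_self hM.eigenvectorUnitary) i) j
    simpa [Matrix.mul_apply, Matrix.one_apply, Matrix.star_apply] using h
  · intro x y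
    have h := congrFun (congrFun hM.spectral_theorem x) y
    rw [Unitary.conjStarAlgAut_apply] at h
    rw [h, Matrix.mul_apply]
    refine Finset.sum_congr rfl fun i _ => ?_
    rw [Matrix.mul_diagonal, Matrix.star_apply]
    simp only [Function.comp_apply, Complex.coe_algebraMap, RCLike.star_def]
    exact congrArg (· * _) (mul_comm _ _)

/-- A matrix is Hermitian and parity-preserving iff it diagonalizes with real eigenvalues
in an orthonormal basis of parity eigenvectors. -/
theorem hermitian_parity_iff_spectral
    {α β : Type*} [Fintype α] [Fintype β] [DecidableEq α] [DecidableEq β]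
    (A : Matrix (α ⊕ β) (α ⊕ β) ℂ) :
    (Aᴴ = A ∧ parityMatrix α β * A * parityMatrix α β = A) ↔
      ∃ (a : (α ⊕ β) → ℝ) (v : (α ⊕ β) → ((α ⊕ β) → ℂ)),
        (∀ i j, ∑ x, conj (v i x) * v j x = if i = j then 1 else 0) ∧
        (∀ i, (parityMatrix α β).mulVec (v i) = v i ∨
          (parityMatrix α β).mulVec (v i) = -(v i)) ∧
        (∀ x y, A x y = ∑ i, (a i : ℂ) * v i x * conj (v i y)) := by
  constructor
  · rintro ⟨hA, hP⟩
    have hPe (x y) := congrFun (congrFun hP x) y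
    simp only [parityMatrix, Matrix.mul_diagonal, Matrix.diagonal_mul] at hPe
    have h₁₂ (x : α) (y : β) : A (.inl x) (.inr y) = 0 :=
      self_eq_neg.mp (by simpa using (hPe (.inl x) (.inr y)).symm)
    have h₂₁ (x : β) (y : α) : A (.inr x) (.inl y) = 0 :=
      self_eq_neg.mp (by simpa using (hPe (.inr x) (.inl y)).symm)
    have hA' : A.IsHermitian := hA
    obtain ⟨a, v, hv, hav⟩ := (hA'.submatrix Sum.inl).exists_orthonormal_expansion
    obtain ⟨b, w, hw, hbw⟩ := (hA'.submatrix Sum.inr).exists_orthonormal_expansion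
    refine ⟨Sum.elim a b,
      Sum.elim (fun i => Sum.elim (v i) 0) (fun i => Sum.elim 0 (w i)), ?_, ?_, ?_⟩
    · rintro (i | i) (j | j) <;> simp [hv, hw]
    · rintro (i | i)
      · left
        ext (x | x) <;> simp [parityMatrix, Matrix.mulVec_diagonal]
      · right
        ext (x | x) <;> simp [parityMatrix, Matrix.mulVec_diagonal]
    · rintro (x | x) (y | y)
      · simpa using hav x y
      · simp [h₁₂]
      · simp [h₂₁]
      · simpa using hbw x y
  · rintro ⟨a, v, -, hv, hA⟩
    constructor
    · ext x y
      rw [Matrix.conjTranspose_apply, hA, hA, star_sum]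
      refine Finset.sum_congr rfl fun i _ => ?_
      simp only [star_mul', RCLike.star_def, Complex.conj_ofReal, Complex.conj_conj]
      ring
    · ext x y
      rw [parityMatrix, Matrix.mul_diagonal, Matrix.diagonal_mul, hA, Finset.mul_sum,
        Finset.sum_mul]
      refine Finset.sum_congr rfl fun i _ => ?_
      rcases hv i with h | h <;>
      · have hx := congrFun h x
        have hy := congrArg conj (congrFun h y)
        rcases x with x | x <;> rcases y with y | y <;>
          simp [parityMatrix, Matrix.mulVec_diagonal, self_eq_neg, neg_eq_self] at hx hy ⊢ <;>
          simp [hx, hy]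
end

section
/- Let n be a finite type and let A, B : Matrix n n ℂ be unitary matrices that anticommute: A * B = −(B * A). Let C_A = Matrix.fromBlocks 1 0 0 A : Matrix (n ⊕ n) (n ⊕ n) ℂ (the controlled-A operation) and I⊗B = Matrix.fromBlocks B 0 0 B. Then C_Aᴴ * (Matrix.fromBlocks Bᴴ 0 0 Bᴴ) * C_A * (Matrix.fromBlocks B 0 0 B) = Matrix.fromBlocks 1 0 0 (−1); in particular, this composite of unitaries maps every vector of the form (v, v) to (v, −v). -/
open scoped Matrix

/-- For anticommuting unitaries `A`, `B`, the composite
`C_Aᴴ * (I ⊗ Bᴴ) * C_A * (I ⊗ B)` equals `fromBlocks 1 0 0 (-1)`; in particular it maps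
every vector of the form `(v, v)` to `(v, -v)`. -/
theorem controlled_anticommuting_unitary_signals
    {n : Type*} [Fintype n] [DecidableEq n]
    (A B : Matrix n n ℂ)
    (hA : A ∈ Matrix.unitaryGroup n ℂ) (hB : B ∈ Matrix.unitaryGroup n ℂ)
    (hanti : A * B = -(B * A)) :
    (Matrix.fromBlocks 1 0 0 A)ᴴ * Matrix.fromBlocks Bᴴ 0 0 Bᴴ *
        Matrix.fromBlocks 1 0 0 A * Matrix.fromBlocks B 0 0 B =
      Matrix.fromBlocks 1 0 0 (-1) ∧
    ∀ v : n → ℂ,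
      ((Matrix.fromBlocks 1 0 0 A)ᴴ * Matrix.fromBlocks Bᴴ 0 0 Bᴴ *
        Matrix.fromBlocks 1 0 0 A * Matrix.fromBlocks B 0 0 B).mulVec (Sum.elim v v) =
        Sum.elim v (-v) := by
  have hA' : Aᴴ * A = 1 := Matrix.mem_unitaryGroup_iff'.mp hA
  have hB' : Bᴴ * B = 1 := Matrix.mem_unitaryGroup_iff'.mp hB
  have hcomm : Aᴴ * Bᴴ * A * B = -1 := by
    rw [Matrix.mul_assoc, hanti, Matrix.mul_neg, Matrix.mul_assoc, ← Matrix.mul_assoc Bᴴ, hB',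
      Matrix.one_mul, hA']
  have hblocks : (Matrix.fromBlocks 1 0 0 A)ᴴ * Matrix.fromBlocks Bᴴ 0 0 Bᴴ *
      Matrix.fromBlocks 1 0 0 A * Matrix.fromBlocks B 0 0 B =
      Matrix.fromBlocks (1 : Matrix n n ℂ) 0 0 (-1 : Matrix n n ℂ) := by
    simp [Matrix.fromBlocks_conjTranspose, Matrix.fromBlocks_multiply, hB', hcomm]
  refine ⟨hblocks, fun v => ?_⟩
  rw [hblocks, Matrix.fromBlocks_mulVec]
  simp [Matrix.neg_mulVec]
end

section
/- Let φ : Matrix ι₁ ι₁ ℂ →ₗ[ℂ] Matrix ι₂ ι₂ ℂ be a ℂ-linear map. The following are equivalent. (1) There exist a finite type κ and a family E : κ → Matrix ι₂ ι₁ ℂ of parity-definite matrices such that ∑ k, (E k)ᴴ * E k is positive semidefinite, 1 − ∑ k, (E k)ᴴ * E k is positive semidefinite, and φ M = ∑ k, E k * M * (E k)ᴴ for every M : Matrix ι₁ ι₁ ℂ. (2) φ satisfies: (a) φ (S₁ * M * S₁) = S₂ * (φ M) * S₂ for all M (parity equivariance); (b) for every parity-preserving density matrix ρ : Matrix ι₁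 ι₁ ℂ, the trace of φ ρ is a real number lying in the interval [0, 1]; (c) φ is SSR-completely positive. -/
open scoped Matrix Kronecker ComplexOrder

/-- The extension `φ ⊗ id` of a map on matrices to matrices with an ancilla factor. -/
noncomputable def extendMap {ι₁ ι₂ ι' : Type*}
    (φ : Matrix ι₁ ι₁ ℂ →ₗ[ℂ] Matrix ι₂ ι₂ ℂ)
    (M : Matrix (ι₁ × ι') (ι₁ × ι') ℂ) : Matrix (ι₂ × ι') (ι₂ × ι') ℂ :=
  Matrix.of fun p q => φ (Matrix.of fun i j => M (i, p.2) (j, q.2)) p.1 q.1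

/-- SSR-complete positivity: for every parity-graded finite ancilla, `φ ⊗ id` sends every
positive semidefinite matrix commuting with the product parity matrix to a positive
semidefinite matrix. -/
def SSRCompletelyPositive
    {α₁ β₁ α₂ β₂ : Type*} [Fintype α₁] [Fintype β₁] [Fintype α₂] [Fintype β₂]
    [DecidableEq α₁] [DecidableEq β₁] [DecidableEq α₂] [DecidableEq β₂]
    (φ : Matrix (α₁ ⊕ β₁) (α₁ ⊕ β₁) ℂ →ₗ[ℂ] Matrix (α₂ ⊕ β₂) (α₂ ⊕ β₂) ℂ) : Prop :=
  ∀ (α' β' : Type) [Fintype α'] [Fintype β'] [DecidableEq α'] [DecidableEq β'],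
    ∀ M : Matrix ((α₁ ⊕ β₁) × (α' ⊕ β')) ((α₁ ⊕ β₁) × (α' ⊕ β')) ℂ,
      M.PosSemidef →
      M * (parityMatrix α₁ β₁ ⊗ₖ parityMatrix α' β') =
        (parityMatrix α₁ β₁ ⊗ₖ parityMatrix α' β') * M →
      (extendMap φ M).PosSemidef

namespace FermionicKraus

open Matrix

section Parity

variable {α β : Type*} [DecidableEq α] [DecidableEq β]

lemma parityMatrix_mul_self [Fintype α] [Fintype β] :
    parityMatrix α β * parityMatrix α β = 1 := by
  rw [parityMatrix, diagonal_mul_diagonal, ← diagonal_one]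
  congr 1
  ext x
  cases x <;> simp

lemma parityMatrix_conjTranspose : (parityMatrix α β)ᴴ = parityMatrix α β := by
  rw [parityMatrix, diagonal_conjTranspose]
  congr 1
  ext x
  cases x <;> simp

end Parity

section Trace

variable {ι₁ ι₂ κ : Type*} [Fintype ι₁] [Fintype ι₂] [Fintype κ]

lemma trace_kraus_sum (E : κ → Matrix ι₂ ι₁ ℂ) (M : Matrix ι₁ ι₁ ℂ) :
    (∑ k, E k * M * (E k)ᴴ).trace = ((∑ k, (E k)ᴴ * E k) * M).trace := by
  rw [trace_sum, Finset.sum_mul, trace_sum]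
  refine Finset.sum_congr rfl fun k _ => ?_
  rw [trace_mul_comm, ← Matrix.mul_assoc]

open scoped MatrixOrder in
lemma trace_mul_nonneg [DecidableEq ι₁] {A B : Matrix ι₁ ι₁ ℂ} (hA : A.PosSemidef)
    (hB : B.PosSemidef) : 0 ≤ (A * B).trace := by
  obtain ⟨C, rfl⟩ := CStarAlgebra.nonneg_iff_eq_star_mul_self.mp hA.nonneg
  rw [star_eq_conjTranspose, Matrix.mul_assoc, trace_mul_comm]
  exact (hB.mul_mul_conjTranspose_same C).trace_nonneg

end Trace

section Extension

variable {ι₁ ι₂ ι' κ : Type*} [Fintype ι₁] [Fintype ι'] [Fintype κ] [DecidableEq ι']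

lemma extendMap_kraus (φ : Matrix ι₁ ι₁ ℂ →ₗ[ℂ] Matrix ι₂ ι₂ ℂ) (E : κ → Matrix ι₂ ι₁ ℂ)
    (h : ∀ M, φ M = ∑ k, E k * M * (E k)ᴴ) (M : Matrix (ι₁ × ι') (ι₁ × ι') ℂ) :
    extendMap φ M =
      ∑ k, (E k ⊗ₖ (1 : Matrix ι' ι' ℂ)) * M * (E k ⊗ₖ (1 : Matrix ι' ι' ℂ))ᴴ := by
  ext ⟨i, a⟩ ⟨j, b⟩
  simp [extendMap, h, Matrix.sum_apply, Matrix.mul_apply, Fintype.sum_prod_type, one_apply,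
    apply_ite]

end Extension

section Choi

variable {ι₁ ι₂ : Type*} [DecidableEq ι₁]

/-- The Choi matrix of a linear map between matrix spaces. -/
def choiMatrix (φ : Matrix ι₁ ι₁ ℂ →ₗ[ℂ] Matrix ι₂ ι₂ ℂ) : Matrix (ι₂ × ι₁) (ι₂ × ι₁) ℂ :=
  of fun p q => φ (single p.2 q.2 1) p.1 q.1

lemma apply_eq_sum_choiMatrix [Fintype ι₁] (φ : Matrix ι₁ ι₁ ℂ →ₗ[ℂ] Matrix ι₂ ι₂ ℂ) (M : Matrix ι₁ ι₁ ℂ)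
    (i j : ι₂) : φ M i j = ∑ a, ∑ b, M a b * choiMatrix φ (i, a) (j, b) := by
  conv_lhs => rw [matrix_eq_sum_single M]
  simp only [map_sum, Matrix.sum_apply, choiMatrix, of_apply]
  refine Finset.sum_congr rfl fun a _ => Finset.sum_congr rfl fun b _ => ?_
  rw [← mul_one (M a b), ← smul_eq_mul, ← smul_single, map_smul, Matrix.smul_apply]
  simp

open scoped MatrixOrder in
lemma exists_kraus_of_choiMatrix_posSemidef [Fintype ι₁] [Fintype ι₂] [DecidableEq ι₂]
    (φ : Matrix ι₁ ι₁ ℂ →ₗ[ℂ] Matrix ι₂ ι₂ ℂ) (h : (choiMatrix φ).PosSemidef) :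
    ∃ E : ι₂ × ι₁ → Matrix ι₂ ι₁ ℂ, ∀ M, φ M = ∑ k, E k * M * (E k)ᴴ := by
  obtain ⟨B, hB⟩ := CStarAlgebra.nonneg_iff_eq_star_mul_self.mp h.nonneg
  refine ⟨fun k => of fun i a => star (B k (i, a)), fun M => ?_⟩
  ext i j
  rw [apply_eq_sum_choiMatrix, hB]
  simp only [star_eq_conjTranspose, Matrix.sum_apply, mul_apply, conjTranspose_apply, of_apply,
    star_star, Finset.mul_sum, Finset.sum_mul]
  rw [Finset.sum_comm]
  conv_rhs => rw [Finset.sum_comm]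
  refine Finset.sum_congr rfl fun b _ => ?_
  rw [Finset.sum_comm]
  refine Finset.sum_congr rfl fun k _ => Finset.sum_congr rfl fun a _ => ?_
  ring

lemma choiMatrix_posSemidef {α₁ β₁ α₂ β₂ : Type*} [Fintype α₁] [Fintype β₁] [Fintype α₂]
    [Fintype β₂] [DecidableEq α₁] [DecidableEq β₁] [DecidableEq α₂] [DecidableEq β₂]
    (φ : Matrix (α₁ ⊕ β₁) (α₁ ⊕ β₁) ℂ →ₗ[ℂ] Matrix (α₂ ⊕ β₂) (α₂ ⊕ β₂) ℂ)
    (h : SSRCompletelyPositive φ) : (choiMatrix φ).PosSemidef := by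
  let e : α₁ ⊕ β₁ ≃ Fin (Fintype.card α₁) ⊕ Fin (Fintype.card β₁) :=
    Equiv.sumCongr (Fintype.equivFin α₁) (Fintype.equivFin β₁)
  let Ω : (α₁ ⊕ β₁) × (Fin (Fintype.card α₁) ⊕ Fin (Fintype.card β₁)) → ℂ :=
    fun p => if e p.1 = p.2 then 1 else 0
  have key := h (Fin (Fintype.card α₁)) (Fin (Fintype.card β₁)) (vecMulVec Ω (star Ω))
    (posSemidef_vecMulVec_self_star Ω) ?_
  · convert key.submatrix (fun p : (α₂ ⊕ β₂) × (α₁ ⊕ β₁) => (p.1, e p.2)) using 1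
    ext ⟨i, a⟩ ⟨j, b⟩
    have hΩ : single a b 1 = of fun p q => vecMulVec Ω (star Ω) (p, e a) (q, e b) := by
      ext p q
      simp [vecMulVec_apply, Ω, single_apply, ← ite_and, and_comm, eq_comm]
    simp only [choiMatrix, extendMap, of_apply, submatrix_apply, hΩ]
  · have hΩ : (parityMatrix α₁ β₁ ⊗ₖ
        parityMatrix (Fin (Fintype.card α₁)) (Fin (Fintype.card β₁))) *ᵥ Ω = Ω := by
      ext ⟨p, q⟩
      rw [parityMatrix, parityMatrix, diagonal_kronecker_diagonal, mulVec_diagonal]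
      rcases p with p | p <;> rcases q with q | q <;> simp [Ω, e]
    have hS : (parityMatrix α₁ β₁ ⊗ₖ
        parityMatrix (Fin (Fintype.card α₁)) (Fin (Fintype.card β₁)))ᴴ = parityMatrix α₁ β₁ ⊗ₖ
        parityMatrix (Fin (Fintype.card α₁)) (Fin (Fintype.card β₁)) := by
      rw [conjTranspose_kronecker, parityMatrix_conjTranspose, parityMatrix_conjTranspose]
    rw [mul_vecMulVec, hΩ, vecMulVec_mul, ← hS, ← star_mulVec, hΩ]

end Choi

section ParityParts

variable {ι₁ ι₂ κ : Type*} [Fintype ι₁] [Fintype ι₂] [Fintype κ]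

/-- The component of `E` of parity `s`, with respect to parity matrices `S₂` and `S₁`. -/
noncomputable def parityPart (S₂ : Matrix ι₂ ι₂ ℂ) (S₁ : Matrix ι₁ ι₁ ℂ) (s : ℂ)
    (E : Matrix ι₂ ι₁ ℂ) : Matrix ι₂ ι₁ ℂ :=
  (2⁻¹ : ℂ) • (E + s • (S₂ * E * S₁))

lemma mul_parityPart_mul [DecidableEq ι₁] [DecidableEq ι₂] {S₂ : Matrix ι₂ ι₂ ℂ}
    {S₁ : Matrix ι₁ ι₁ ℂ} (h₂ : S₂ * S₂ = 1) (h₁ : S₁ * S₁ = 1) {s : ℂ} (hs : s * s = 1)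
    (E : Matrix ι₂ ι₁ ℂ) :
    S₂ * parityPart S₂ S₁ s E * S₁ = s • parityPart S₂ S₁ s E := by
  have h : S₂ * (S₂ * E * S₁) * S₁ = E := by
    rw [Matrix.mul_assoc S₂ E, ← Matrix.mul_assoc S₂ S₂, h₂, Matrix.one_mul, Matrix.mul_assoc,
      h₁, Matrix.mul_one]
  simp only [parityPart, Matrix.mul_smul, Matrix.smul_mul, Matrix.mul_add, Matrix.add_mul, h]
  rw [smul_comm s, smul_add s, smul_smul s s, hs, one_smul, add_comm]

lemma parityPart_sandwich_add (S₂ : Matrix ι₂ ι₂ ℂ) (S₁ : Matrix ι₁ ι₁ ℂ)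
    (E : Matrix ι₂ ι₁ ℂ) (M : Matrix ι₁ ι₁ ℂ) :
    parityPart S₂ S₁ 1 E * M * (parityPart S₂ S₁ 1 E)ᴴ +
      parityPart S₂ S₁ (-1) E * M * (parityPart S₂ S₁ (-1) E)ᴴ =
    (2⁻¹ : ℂ) • (E * M * Eᴴ + (S₂ * E * S₁) * M * (S₂ * E * S₁)ᴴ) := by
  simp only [parityPart]
  generalize S₂ * E * S₁ = F
  simp only [conjTranspose_smul, conjTranspose_add, Matrix.add_mul, Matrix.mul_add,
    Matrix.smul_mul, Matrix.mul_smul, star_inv₀, star_ofNat, star_neg, star_one, one_smul]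
  module

lemma apply_eq_sum_parityPart [DecidableEq ι₁] [DecidableEq ι₂] {S₂ : Matrix ι₂ ι₂ ℂ}
    {S₁ : Matrix ι₁ ι₁ ℂ} (h₂ : S₂ * S₂ = 1) (h₂' : S₂ᴴ = S₂) (h₁' : S₁ᴴ = S₁)
    (φ : Matrix ι₁ ι₁ ℂ →ₗ[ℂ] Matrix ι₂ ι₂ ℂ)
    (hφ : ∀ M, φ (S₁ * M * S₁) = S₂ * φ M * S₂) (E : κ → Matrix ι₂ ι₁ ℂ)
    (hE : ∀ M, φ M = ∑ k, E k * M * (E k)ᴴ) (M : Matrix ι₁ ι₁ ℂ) :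
    φ M = ∑ k, (parityPart S₂ S₁ 1 (E k) * M * (parityPart S₂ S₁ 1 (E k))ᴴ +
      parityPart S₂ S₁ (-1) (E k) * M * (parityPart S₂ S₁ (-1) (E k))ᴴ) := by
  have h : φ M = ∑ k, (S₂ * E k * S₁) * M * (S₂ * E k * S₁)ᴴ := by
    have h' : φ M = S₂ * φ (S₁ * M * S₁) * S₂ := by
      rw [hφ, Matrix.mul_assoc S₂ (φ M), ← Matrix.mul_assoc S₂ S₂, h₂, Matrix.one_mul,
        Matrix.mul_assoc, h₂, Matrix.mul_one]
    rw [h', hE, Finset.mul_sum, Finset.sum_mul]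
    simp only [conjTranspose_mul, h₁', h₂', Matrix.mul_assoc]
  simp only [parityPart_sandwich_add, ← Finset.smul_sum, Finset.sum_add_distrib]
  rw [← h, ← hE]
  module

end ParityParts

section TraceBound

variable {ι₁ ι₂ : Type*} [Fintype ι₁] [Fintype ι₂]

/-- For a parity-equivariant map, a trace bound on even density matrices extends to a bound on all
positive semidefinite matrices. -/
lemma trace_apply_le [DecidableEq ι₁] [DecidableEq ι₂] {S₂ : Matrix ι₂ ι₂ ℂ}
    {S₁ : Matrix ι₁ ι₁ ℂ} (h₂ : S₂ * S₂ = 1) (h₁ : S₁ * S₁ = 1) (h₁' : S₁ᴴ = S₁)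
    (φ : Matrix ι₁ ι₁ ℂ →ₗ[ℂ] Matrix ι₂ ι₂ ℂ)
    (hφ : ∀ M, φ (S₁ * M * S₁) = S₂ * φ M * S₂)
    (ht : ∀ ρ : Matrix ι₁ ι₁ ℂ, ρ.PosSemidef → ρ.trace = 1 → S₁ * ρ * S₁ = ρ → (φ ρ).trace ≤ 1)
    {N : Matrix ι₁ ι₁ ℂ} (hN : N.PosSemidef) : (φ N).trace ≤ N.trace := by
  rcases eq_or_ne N.trace 0 with h0 | h0
  · simp [hN.trace_eq_zero_iff.mp h0]
  have hpos : 0 < N.trace := lt_of_le_of_ne hN.trace_nonneg h0.symm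
  have hSS : S₁ * (S₁ * N * S₁) * S₁ = N := by
    rw [Matrix.mul_assoc S₁ N, ← Matrix.mul_assoc S₁ S₁, h₁, Matrix.one_mul, Matrix.mul_assoc,
      h₁, Matrix.mul_one]
  have hSN : (S₁ * N * S₁).PosSemidef := by
    simpa [h₁'] using hN.mul_mul_conjTranspose_same S₁
  have hc : (0 : ℂ) ≤ N.trace⁻¹ * 2⁻¹ :=
    mul_nonneg (inv_nonneg.mpr hpos.le) (inv_nonneg.mpr zero_le_two)
  have key := ht ((N.trace⁻¹ * 2⁻¹) • (N + S₁ * N * S₁)) ((hN.add hSN).smul hc) ?_ ?_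
  · rw [map_smul, map_add, hφ, trace_smul, trace_add, trace_mul_cycle, h₂, Matrix.one_mul,
      smul_eq_mul] at key
    have e : N.trace⁻¹ * 2⁻¹ * ((φ N).trace + (φ N).trace) = N.trace⁻¹ * (φ N).trace := by ring
    rw [e] at key
    simpa [mul_inv_cancel_left₀ h0] using mul_le_mul_of_nonneg_left key hpos.le
  · rw [trace_smul, trace_add, trace_mul_cycle, h₁, Matrix.one_mul, smul_eq_mul]
    field_simp
    norm_num
  · rw [Matrix.mul_smul, Matrix.smul_mul, Matrix.mul_add, Matrix.add_mul, hSS, add_comm]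

lemma posSemidef_one_sub_of_trace_le [DecidableEq ι₁] {A : Matrix ι₁ ι₁ ℂ} (hA : A.IsHermitian)
    (h : ∀ N : Matrix ι₁ ι₁ ℂ, N.PosSemidef → (A * N).trace ≤ N.trace) :
    (1 - A).PosSemidef := by
  refine .of_dotProduct_mulVec_nonneg (isHermitian_one.sub hA) fun x => ?_
  have := h _ (posSemidef_vecMulVec_self_star x)
  rw [mul_vecMulVec, trace_vecMulVec, trace_vecMulVec] at this
  rw [sub_mulVec, one_mulVec, dotProduct_sub, dotProduct_comm, dotProduct_comm (star x)]
  exact sub_nonneg.mpr this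

end TraceBound

end FermionicKraus

open FermionicKraus in
/-- Equivalence between the operator-sum (Kraus) representation with parity-definite Kraus
operators and the axiomatic formulation (parity equivariance, trace a probability on
parity-preserving density matrices, SSR-complete positivity) of general fermionic quantum
operations. -/
theorem fermionic_quantum_operation_kraus_iff_axiomatic
    {α₁ β₁ α₂ β₂ : Type*} [Fintype α₁] [Fintype β₁] [Fintype α₂] [Fintype β₂]
    [DecidableEq α₁] [DecidableEq β₁] [DecidableEq α₂] [DecidableEq β₂]
    (φ : Matrix (α₁ ⊕ β₁) (α₁ ⊕ β₁) ℂ →ₗ[ℂ] Matrix (α₂ ⊕ β₂) (α₂ ⊕ β₂) ℂ) :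
    (∃ (n : ℕ) (E : Fin n → Matrix (α₂ ⊕ β₂) (α₁ ⊕ β₁) ℂ),
      (∀ k, parityMatrix α₂ β₂ * E k * parityMatrix α₁ β₁ = E k ∨
        parityMatrix α₂ β₂ * E k * parityMatrix α₁ β₁ = -(E k)) ∧
      (∑ k, (E k)ᴴ * E k).PosSemidef ∧
      (1 - ∑ k, (E k)ᴴ * E k).PosSemidef ∧
      (∀ M, φ M = ∑ k, E k * M * (E k)ᴴ)) ↔
    ((∀ M, φ (parityMatrix α₁ β₁ * M * parityMatrix α₁ β₁) =
        parityMatrix α₂ β₂ * φ M * parityMatrix α₂ β₂) ∧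
     (∀ ρ : Matrix (α₁ ⊕ β₁) (α₁ ⊕ β₁) ℂ, ρ.PosSemidef → ρ.trace = 1 →
        parityMatrix α₁ β₁ * ρ * parityMatrix α₁ β₁ = ρ →
        (φ ρ).trace.im = 0 ∧ 0 ≤ (φ ρ).trace.re ∧ (φ ρ).trace.re ≤ 1) ∧
     SSRCompletelyPositive φ) := by
  have h₁ := parityMatrix_mul_self (α := α₁) (β := β₁)
  have h₂ := parityMatrix_mul_self (α := α₂) (β := β₂)
  have h₁' := parityMatrix_conjTranspose (α := α₁) (β := β₁)
  have h₂' := parityMatrix_conjTranspose (α := α₂) (β := β₂)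
  constructor
  · rintro ⟨n, E, hpar, hA, hA', hφ⟩
    refine ⟨fun M => ?_, fun ρ hρ hρ1 _ => ?_, ?_⟩
    · rw [hφ, hφ, Finset.mul_sum, Finset.sum_mul]
      refine Finset.sum_congr rfl fun k _ => ?_
      have h : parityMatrix α₂ β₂ * (E k * M * (E k)ᴴ) * parityMatrix α₂ β₂ =
          (parityMatrix α₂ β₂ * E k * parityMatrix α₁ β₁) *
            (parityMatrix α₁ β₁ * M * parityMatrix α₁ β₁) *
            (parityMatrix α₂ β₂ * E k * parityMatrix α₁ β₁)ᴴ := by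
        simp only [Matrix.conjTranspose_mul, h₁', h₂', Matrix.mul_assoc]
        simp only [← Matrix.mul_assoc (parityMatrix α₁ β₁) (parityMatrix α₁ β₁), h₁,
          Matrix.one_mul]
      rw [h]
      rcases hpar k with hk | hk <;> simp [hk]
    · have hle := trace_mul_nonneg hA' hρ
      rw [Matrix.sub_mul, Matrix.one_mul, Matrix.trace_sub, hρ1, ← trace_kraus_sum, ← hφ,
        sub_nonneg] at hle
      have hge := trace_mul_nonneg hA hρ
      rw [← trace_kraus_sum, ← hφ] at hge
      rw [Complex.le_def] at hle hge
      exact ⟨hge.2.symm, hge.1, hle.1⟩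
    · intro α' β' _ _ _ _ M hM _
      rw [extendMap_kraus φ E hφ]
      exact Matrix.posSemidef_sum _ fun k _ => hM.mul_mul_conjTranspose_same _
  · rintro ⟨heq, htr, hcp⟩
    obtain ⟨F, hF⟩ := exists_kraus_of_choiMatrix_posSemidef φ (choiMatrix_posSemidef φ hcp)
    let G := fun k : ((α₂ ⊕ β₂) × (α₁ ⊕ β₁)) ⊕ ((α₂ ⊕ β₂) × (α₁ ⊕ β₁)) =>
      Sum.elim (fun k => parityPart (parityMatrix α₂ β₂) (parityMatrix α₁ β₁) 1 (F k))
        (fun k => parityPart (parityMatrix α₂ β₂) (parityMatrix α₁ β₁) (-1) (F k)) k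
    have hG : ∀ M, φ M = ∑ k, G k * M * (G k)ᴴ := fun M => by
      rw [apply_eq_sum_parityPart h₂ h₂' h₁' φ heq F hF, Fintype.sum_sum_type,
        Finset.sum_add_distrib]
      rfl
    have hGpar : ∀ k, parityMatrix α₂ β₂ * G k * parityMatrix α₁ β₁ = G k ∨
        parityMatrix α₂ β₂ * G k * parityMatrix α₁ β₁ = -(G k) := by
      rintro (k | k)
      · exact .inl <| by simpa [G] using mul_parityPart_mul h₂ h₁ (s := 1) (by norm_num) (F k)
      · exact .inr <| by simpa [G] using mul_parityPart_mul h₂ h₁ (s := -1) (by norm_num) (F k)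
    let e := (Fintype.equivFin (((α₂ ⊕ β₂) × (α₁ ⊕ β₁)) ⊕ ((α₂ ⊕ β₂) × (α₁ ⊕ β₁)))).symm
    have hsum : ∑ k, (G (e k))ᴴ * G (e k) = ∑ k, (G k)ᴴ * G k :=
      e.sum_comp fun k => (G k)ᴴ * G k
    have hpos : (∑ k, (G k)ᴴ * G k).PosSemidef :=
      Matrix.posSemidef_sum _ fun k _ => Matrix.posSemidef_conjTranspose_mul_self _
    refine ⟨_, fun k => G (e k), fun k => hGpar _, hsum ▸ hpos, ?_, fun M => ?_⟩
    · rw [hsum]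
      refine posSemidef_one_sub_of_trace_le hpos.isHermitian fun N hN => ?_
      rw [← trace_kraus_sum, ← hG]
      refine trace_apply_le h₂ h₁ h₁' φ heq (fun ρ hρ hρ1 hρS => ?_) hN
      obtain ⟨him, -, hre⟩ := htr ρ hρ hρ1 hρS
      exact Complex.le_def.mpr ⟨hre, him⟩
    · rw [hG]
      exact (e.sum_comp fun k => G k * M * (G k)ᴴ).symm
end

section
/- Let φ : Matrix ι₁ ι₁ ℂ →ₗ[ℂ] Matrix ι₂ ι₂ ℂ be a ℂ-linear map. The following are equivalent. (1) There exist a finite type κ and a family E : κ → Matrix ι₂ ι₁ ℂ of parity-definite matrices such that ∑ k, (E k)ᴴ * E k = 1 and φ M = ∑ k, E k * M * (E k)ᴴ for every M : Matrix ι₁ ι₁ ℂ. (2) φ satisfies: (a) φ (S₁ * M * S₁) = S₂ * (φ M) * S₂ for all M (parity equivariance); (b) for every parity-preserving density matrix ρ : Matrix ι₁ ι₁ ℂ, the trace of φ ρ equals the trace of ρ; (c) φ is SSR-completely positive. -/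
open scoped Matrix Kronecker ComplexOrder

lemma parityMatrix_conjTranspose (α β : Type*) [DecidableEq α] [DecidableEq β] :
    (parityMatrix α β)ᴴ = parityMatrix α β := by
  rw [parityMatrix, Matrix.diagonal_conjTranspose]
  congr 1
  ext (i | i) <;> simp

lemma parityMatrix_mul_self (α β : Type*) [Fintype α] [Fintype β] [DecidableEq α]
    [DecidableEq β] : parityMatrix α β * parityMatrix α β = 1 := by
  rw [parityMatrix, Matrix.diagonal_mul_diagonal, ← Matrix.diagonal_one]
  congr 1
  ext (i | i) <;> simp

/-- The extension of an operator-sum map is the operator sum of the extended Kraus matrices. -/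
lemma extendMap_eq_sum_kronecker {ι₁ ι₂ ι' κ : Type*} [Fintype ι₁] [Fintype ι']
    [DecidableEq ι'] [Fintype κ] {φ : Matrix ι₁ ι₁ ℂ →ₗ[ℂ] Matrix ι₂ ι₂ ℂ}
    {E : κ → Matrix ι₂ ι₁ ℂ} (hφ : ∀ M, φ M = ∑ k, E k * M * (E k)ᴴ)
    (M : Matrix (ι₁ × ι') (ι₁ × ι') ℂ) :
    extendMap φ M = ∑ k, (E k ⊗ₖ (1 : Matrix ι' ι' ℂ)) * M *
      (E k ⊗ₖ (1 : Matrix ι' ι' ℂ))ᴴ := by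
  ext ⟨i, a⟩ ⟨j, b⟩
  simp only [extendMap, hφ, Matrix.of_apply, Matrix.sum_apply, Matrix.mul_apply,
    Matrix.conjTranspose_apply, Matrix.kronecker_apply, Fintype.sum_prod_type, Matrix.one_apply,
    mul_ite, mul_one, mul_zero, ite_mul, zero_mul, Finset.sum_ite_eq, Finset.mem_univ, if_true,
    apply_ite star, star_zero]

open scoped MatrixOrder Matrix.Norms.L2Operator in
/-- A Kraus decomposition of a map whose Choi matrix, with the second factor reindexed along `e`,
is positive semidefinite. -/
lemma exists_kraus_of_choi_posSemidef {ι₁ ι₂ ι' : Type*} [Fintype ι₁] [Fintype ι₂]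
    [Fintype ι'] [DecidableEq ι₁] [DecidableEq ι₂] [DecidableEq ι'] (e : ι₁ ≃ ι')
    (φ : Matrix ι₁ ι₁ ℂ →ₗ[ℂ] Matrix ι₂ ι₂ ℂ)
    (hC : (Matrix.of fun p q : ι₂ × ι' =>
      φ (Matrix.single (e.symm p.2) (e.symm q.2) 1) p.1 q.1).PosSemidef) :
    ∃ F : ι₂ × ι' → Matrix ι₂ ι₁ ℂ, ∀ M, φ M = ∑ k, F k * M * (F k)ᴴ := by
  obtain ⟨B, hB⟩ := CStarAlgebra.nonneg_iff_eq_star_mul_self.mp hC.nonneg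
  refine ⟨fun k => Matrix.of fun i p => star (B k (i, e p)), fun M => ?_⟩
  have hsingle : ∀ p q i j, φ (Matrix.single p q 1) i j =
      ∑ k, star (B k (i, e p)) * B k (j, e q) := by
    intro p q i j
    simpa [Matrix.mul_apply] using congrFun (congrFun hB (i, e p)) (j, e q)
  ext i j
  conv_lhs => rw [Matrix.matrix_eq_sum_single M]
  have hs : ∀ p q, Matrix.single p q (M p q) = M p q • Matrix.single p q (1 : ℂ) := by
    intro p q
    simp [Matrix.smul_single]
  simp only [hs, map_sum, map_smul, Matrix.sum_apply, Matrix.smul_apply, hsingle, smul_eq_mul,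
    Matrix.mul_apply, Matrix.conjTranspose_apply, Matrix.of_apply, star_star, Finset.mul_sum,
    Finset.sum_mul]
  rw [Finset.sum_comm]
  conv_lhs => enter [2, q]; rw [Finset.sum_comm]
  rw [Finset.sum_comm]
  refine Finset.sum_congr rfl fun k _ => Finset.sum_congr rfl fun q _ =>
    Finset.sum_congr rfl fun p _ => by ring

/-- An SSR-completely positive map has a Kraus decomposition. -/
lemma SSRCompletelyPositive.exists_kraus
    {α₁ β₁ α₂ β₂ : Type*} [Fintype α₁] [Fintype β₁] [Fintype α₂] [Fintype β₂]
    [DecidableEq α₁] [DecidableEq β₁] [DecidableEq α₂] [DecidableEq β₂]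
    {φ : Matrix (α₁ ⊕ β₁) (α₁ ⊕ β₁) ℂ →ₗ[ℂ] Matrix (α₂ ⊕ β₂) (α₂ ⊕ β₂) ℂ}
    (h : SSRCompletelyPositive φ) :
    ∃ F : (α₂ ⊕ β₂) × (Fin (Fintype.card α₁) ⊕ Fin (Fintype.card β₁)) →
        Matrix (α₂ ⊕ β₂) (α₁ ⊕ β₁) ℂ,
      ∀ M, φ M = ∑ k, F k * M * (F k)ᴴ := by
  let e : α₁ ⊕ β₁ ≃ Fin (Fintype.card α₁) ⊕ Fin (Fintype.card β₁) :=
    Equiv.sumCongr (Fintype.equivFin α₁) (Fintype.equivFin β₁)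
  let w : (α₁ ⊕ β₁) × (Fin (Fintype.card α₁) ⊕ Fin (Fintype.card β₁)) → ℂ :=
    fun x => if e x.1 = x.2 then 1 else 0
  have hw : ∀ x, star (w x) = w x := by
    intro x
    by_cases hx : e x.1 = x.2 <;> simp [w, hx]
  have key := h (Fin (Fintype.card α₁)) (Fin (Fintype.card β₁))
    (Matrix.vecMulVec w (star w)) (Matrix.posSemidef_vecMulVec_self_star w) (by
      simp only [parityMatrix, Matrix.diagonal_kronecker_diagonal]
      ext ⟨i, a⟩ ⟨j, b⟩
      simp only [Matrix.mul_diagonal, Matrix.diagonal_mul, Matrix.vecMulVec_apply, Pi.star_apply,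
        hw]
      by_cases h₁ : e i = a
      · by_cases h₂ : e j = b
        · subst h₁ h₂
          rcases i with i | i <;> rcases j with j | j <;> simp [w, e]
        · simp [w, h₂]
      · simp [w, h₁])
  refine exists_kraus_of_choi_posSemidef e φ (by
    convert key using 1
    ext ⟨i, a⟩ ⟨j, b⟩
    simp only [extendMap, Matrix.of_apply]
    refine congrFun (congrFun (congrArg φ ?_) i) j
    ext p q
    simp only [Matrix.of_apply, Matrix.vecMulVec_apply, Pi.star_apply, w, Matrix.single_apply,
      Equiv.symm_apply_eq]
    by_cases h₁ : a = e p <;> by_cases h₂ : b = e q <;> simp [h₁, h₂, eq_comm])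

/-- Averaging a Kraus decomposition of an equivariant map over the two parities makes it
parity-definite. -/
lemma exists_parity_definite_kraus
    {ι₁ ι₂ κ : Type*} [Fintype ι₁] [Fintype ι₂] [Fintype κ] [DecidableEq ι₁] [DecidableEq ι₂]
    {S₁ : Matrix ι₁ ι₁ ℂ} {S₂ : Matrix ι₂ ι₂ ℂ} (hS₁ : S₁ * S₁ = 1) (hS₂ : S₂ * S₂ = 1)
    (hS₁' : S₁ᴴ = S₁) (hS₂' : S₂ᴴ = S₂)
    {φ : Matrix ι₁ ι₁ ℂ →ₗ[ℂ] Matrix ι₂ ι₂ ℂ} (hφ : ∀ M, φ (S₁ * M * S₁) = S₂ * φ M * S₂)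
    {F : κ → Matrix ι₂ ι₁ ℂ} (hF : ∀ M, φ M = ∑ k, F k * M * (F k)ᴴ) :
    ∃ (n : ℕ) (E : Fin n → Matrix ι₂ ι₁ ℂ),
      (∀ k, S₂ * E k * S₁ = E k ∨ S₂ * E k * S₁ = -(E k)) ∧
      ∀ M, φ M = ∑ k, E k * M * (E k)ᴴ := by
  have hinv : ∀ A : Matrix ι₂ ι₁ ℂ, S₂ * (S₂ * A * S₁) * S₁ = A := by
    intro A
    calc S₂ * (S₂ * A * S₁) * S₁ = (S₂ * S₂) * A * (S₁ * S₁) := by simp only [Matrix.mul_assoc]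
      _ = A := by rw [hS₁, hS₂, Matrix.one_mul, Matrix.mul_one]
  let G : κ ⊕ κ → Matrix ι₂ ι₁ ℂ :=
    Sum.elim (fun k => (1 / 2 : ℂ) • (F k + S₂ * F k * S₁))
      (fun k => (1 / 2 : ℂ) • (F k - S₂ * F k * S₁))
  let e := Fintype.equivFin (κ ⊕ κ)
  have hG : ∀ k, S₂ * G k * S₁ = G k ∨ S₂ * G k * S₁ = -(G k) := by
    rintro (k | k)
    · left
      simp only [G, Sum.elim_inl, Matrix.mul_smul, Matrix.smul_mul, Matrix.mul_add,
        Matrix.add_mul, hinv, add_comm]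
    · right
      simp only [G, Sum.elim_inr, Matrix.mul_smul, Matrix.smul_mul, Matrix.mul_sub,
        Matrix.sub_mul, hinv, ← smul_neg, neg_sub]
  refine ⟨_, fun k => G (e.symm k), fun k => hG _, fun M => ?_⟩
  rw [Equiv.sum_comp e.symm fun k => G k * M * (G k)ᴴ, Fintype.sum_sum_type,
    ← Finset.sum_add_distrib]
  have hhalf : star (1 / 2 : ℂ) = 1 / 2 := by simp
  have hterm : ∀ k, G (.inl k) * M * (G (.inl k))ᴴ + G (.inr k) * M * (G (.inr k))ᴴ =
      (1 / 2 : ℂ) • (F k * M * (F k)ᴴ + S₂ * (F k * (S₁ * M * S₁) * (F k)ᴴ) * S₂) := by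
    intro k
    have hconj : S₂ * (F k * (S₁ * M * S₁) * (F k)ᴴ) * S₂ =
        (S₂ * F k * S₁) * M * (S₂ * F k * S₁)ᴴ := by
      simp only [Matrix.conjTranspose_mul, hS₁', hS₂', Matrix.mul_assoc]
    rw [hconj]
    simp only [G, Sum.elim_inl, Sum.elim_inr, Matrix.conjTranspose_smul, hhalf,
      Matrix.conjTranspose_add, Matrix.conjTranspose_sub, Matrix.smul_mul, Matrix.mul_smul,
      Matrix.add_mul, Matrix.sub_mul, Matrix.mul_add, Matrix.mul_sub]
    module
  simp only [hterm]
  rw [← Finset.smul_sum, Finset.sum_add_distrib, ← hF, ← Finset.sum_mul, ← Finset.mul_sum,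
    ← hF, hφ]
  have : S₂ * (S₂ * φ M * S₂) * S₂ = φ M := by
    calc S₂ * (S₂ * φ M * S₂) * S₂ = (S₂ * S₂) * φ M * (S₂ * S₂) := by
          simp only [Matrix.mul_assoc]
      _ = φ M := by rw [hS₂, Matrix.one_mul, Matrix.mul_one]
  rw [this]
  module

lemma trace_sum_mul_conjTranspose {ι₁ ι₂ κ : Type*} [Fintype ι₁] [Fintype ι₂] [Fintype κ]
    (E : κ → Matrix ι₂ ι₁ ℂ) (M : Matrix ι₁ ι₁ ℂ) :
    (∑ k, E k * M * (E k)ᴴ).trace = ((∑ k, (E k)ᴴ * E k) * M).trace := by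
  rw [Matrix.trace_sum, Matrix.sum_mul, Matrix.trace_sum]
  refine Finset.sum_congr rfl fun k _ => ?_
  rw [Matrix.trace_mul_comm, Matrix.mul_assoc]

/-- A Hermitian matrix fixed by an involution `S` that has trace one against every density matrix
fixed by `S` is the identity. -/
lemma eq_one_of_trace_mul_eq_one {ι : Type*} [Fintype ι] [DecidableEq ι]
    {S G : Matrix ι ι ℂ} (hS : S * S = 1) (hG : Gᴴ = G) (hSG : S * G * S = G)
    (h : ∀ ρ : Matrix ι ι ℂ, ρ.PosSemidef → ρ.trace = 1 → S * ρ * S = ρ →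
      (G * ρ).trace = ρ.trace) : G = 1 := by
  have hall : ∀ P : Matrix ι ι ℂ, P.PosSemidef → S * P * S = P →
      (G * P).trace = P.trace := by
    intro P hP hSP
    by_cases ht : P.trace = 0
    · rw [hP.trace_eq_zero_iff.mp ht, Matrix.mul_zero]
    · have := h (P.trace⁻¹ • P) (hP.smul (inv_nonneg.mpr hP.trace_nonneg))
        (by rw [Matrix.trace_smul, smul_eq_mul, inv_mul_cancel₀ ht])
        (by rw [Matrix.mul_smul, Matrix.smul_mul, hSP])
      rw [Matrix.mul_smul, Matrix.trace_smul, Matrix.trace_smul, smul_eq_mul, smul_eq_mul] at this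
      exact mul_left_cancel₀ (inv_ne_zero ht) this
  have hsq : ∀ A : Matrix ι ι ℂ, Aᴴ = A → S * A * S = A →
      (G * (A * A)).trace = (A * A).trace := by
    intro A hA hSA
    refine hall _ ?_ ?_
    · simpa only [hA] using Matrix.posSemidef_conjTranspose_mul_self A
    · calc S * (A * A) * S = S * A * (S * S) * A * S := by
            rw [hS, Matrix.mul_one]; simp only [Matrix.mul_assoc]
        _ = (S * A * S) * (S * A * S) := by simp only [Matrix.mul_assoc]
        _ = A * A := by rw [hSA]
  have h1 := hsq 1 Matrix.conjTranspose_one (by rw [Matrix.mul_one, hS])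
  have h2 := hsq G hG hSG
  have hH : (G - 1)ᴴ = G - 1 := by rw [Matrix.conjTranspose_sub, hG, Matrix.conjTranspose_one]
  have h3 := hsq (G - 1) hH
    (by rw [Matrix.mul_sub, Matrix.sub_mul, hSG, Matrix.mul_one, hS])
  have hzero : ((G - 1)ᴴ * (G - 1)).trace = 0 := by
    rw [hH]
    simp only [Matrix.mul_sub, Matrix.sub_mul, Matrix.mul_one, Matrix.one_mul, Matrix.trace_sub]
      at h1 h2 h3 ⊢
    linear_combination (1 / 2 : ℂ) * h2 - (1 / 2 : ℂ) * h3 - (1 / 2 : ℂ) * h1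
  exact sub_eq_zero.mp (Matrix.trace_conjTranspose_mul_self_eq_zero_iff.mp hzero)

/-- Equivalence between the trace-preserving operator-sum (Kraus) representation with
parity-definite Kraus operators and the axiomatic formulation (parity equivariance,
trace preservation on parity-preserving density matrices, SSR-complete positivity) of
general fermionic quantum channels. -/
theorem fermionic_quantum_channel_kraus_iff_axiomatic
    {α₁ β₁ α₂ β₂ : Type*} [Fintype α₁] [Fintype β₁] [Fintype α₂] [Fintype β₂]
    [DecidableEq α₁] [DecidableEq β₁] [DecidableEq α₂] [DecidableEq β₂]
    (φ : Matrix (α₁ ⊕ β₁) (α₁ ⊕ β₁) ℂ →ₗ[ℂ] Matrix (α₂ ⊕ β₂) (α₂ ⊕ β₂) ℂ) :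
    (∃ (n : ℕ) (E : Fin n → Matrix (α₂ ⊕ β₂) (α₁ ⊕ β₁) ℂ),
      (∀ k, parityMatrix α₂ β₂ * E k * parityMatrix α₁ β₁ = E k ∨
        parityMatrix α₂ β₂ * E k * parityMatrix α₁ β₁ = -(E k)) ∧
      (∑ k, (E k)ᴴ * E k) = 1 ∧
      (∀ M, φ M = ∑ k, E k * M * (E k)ᴴ)) ↔
    ((∀ M, φ (parityMatrix α₁ β₁ * M * parityMatrix α₁ β₁) =
        parityMatrix α₂ β₂ * φ M * parityMatrix α₂ β₂) ∧
     (∀ ρ : Matrix (α₁ ⊕ β₁) (α₁ ⊕ β₁) ℂ, ρ.PosSemidef → ρ.trace = 1 →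
        parityMatrix α₁ β₁ * ρ * parityMatrix α₁ β₁ = ρ →
        (φ ρ).trace = ρ.trace) ∧
     SSRCompletelyPositive φ) := by
  have hS₁ := parityMatrix_mul_self α₁ β₁
  have hS₂ := parityMatrix_mul_self α₂ β₂
  have hS₁' := parityMatrix_conjTranspose α₁ β₁
  have hS₂' := parityMatrix_conjTranspose α₂ β₂
  constructor
  · rintro ⟨n, E, hE, hsum, hφ⟩
    refine ⟨fun M => ?_, fun ρ _ _ _ => ?_, ?_⟩
    · rw [hφ, hφ, Finset.mul_sum, Finset.sum_mul]
      refine Finset.sum_congr rfl fun k _ => ?_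
      have hconj : parityMatrix α₂ β₂ * (E k * M * (E k)ᴴ) * parityMatrix α₂ β₂ =
          (parityMatrix α₂ β₂ * E k * parityMatrix α₁ β₁) *
            (parityMatrix α₁ β₁ * M * parityMatrix α₁ β₁) *
            (parityMatrix α₂ β₂ * E k * parityMatrix α₁ β₁)ᴴ := by
        calc _ = parityMatrix α₂ β₂ * E k * (parityMatrix α₁ β₁ * parityMatrix α₁ β₁) * M *
              (parityMatrix α₁ β₁ * parityMatrix α₁ β₁) * (E k)ᴴ * parityMatrix α₂ β₂ := by
              rw [hS₁]; simp only [Matrix.mul_one, Matrix.mul_assoc]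
          _ = _ := by simp only [Matrix.conjTranspose_mul, hS₁', hS₂', Matrix.mul_assoc]
      rw [hconj]
      rcases hE k with h | h <;> rw [h]
      rw [Matrix.conjTranspose_neg, Matrix.neg_mul, Matrix.neg_mul, Matrix.mul_neg, neg_neg]
    · rw [hφ, trace_sum_mul_conjTranspose, hsum, Matrix.one_mul]
    · intro α' β' _ _ _ _ M hM _
      rw [extendMap_eq_sum_kronecker hφ]
      exact Matrix.posSemidef_sum _ fun k _ => hM.mul_mul_conjTranspose_same _
  · rintro ⟨hequiv, htrace, hcp⟩
    obtain ⟨F, hF⟩ := hcp.exists_kraus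
    obtain ⟨n, E, hE, hφ⟩ := exists_parity_definite_kraus hS₁ hS₂ hS₁' hS₂' hequiv hF
    refine ⟨n, E, hE, eq_one_of_trace_mul_eq_one hS₁ ?_ ?_ fun ρ hρ ht hSρ => ?_, hφ⟩
    · simp only [Matrix.conjTranspose_sum, Matrix.conjTranspose_mul,
        Matrix.conjTranspose_conjTranspose]
    · rw [Finset.mul_sum, Finset.sum_mul]
      refine Finset.sum_congr rfl fun k _ => ?_
      have hconj : parityMatrix α₁ β₁ * ((E k)ᴴ * E k) * parityMatrix α₁ β₁ =
          (parityMatrix α₂ β₂ * E k * parityMatrix α₁ β₁)ᴴ *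
            (parityMatrix α₂ β₂ * E k * parityMatrix α₁ β₁) := by
        calc _ = parityMatrix α₁ β₁ * (E k)ᴴ * (parityMatrix α₂ β₂ * parityMatrix α₂ β₂) *
              E k * parityMatrix α₁ β₁ := by
              rw [hS₂]; simp only [Matrix.mul_one, Matrix.mul_assoc]
          _ = _ := by simp only [Matrix.conjTranspose_mul, hS₁', hS₂', Matrix.mul_assoc]
      rw [hconj]
      rcases hE k with h | h <;> rw [h]
      rw [Matrix.conjTranspose_neg, Matrix.neg_mul, Matrix.mul_neg, neg_neg]
    · rw [← trace_sum_mul_conjTranspose, ← hφ, htrace ρ hρ ht hSρ]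
end

section
/- Let ι = α ⊕ β with parity matrix S and let ι_E = α_E ⊕ β_E be a parity-graded finite type with parity matrix S_E. Let ψ : ι_E → ℂ be a unit vector that is a parity eigenvector of S_E, and let U : Matrix (ι × ι_E) (ι × ι_E) ℂ be a unitary matrix commuting with the Kronecker product S ⊗ S_E. Define, for ρ : Matrix ι ι ℂ, the matrix φ ρ : Matrix ι ι ℂ by (φ ρ) x x' = ∑ y, (U * (ρ ⊗ |ψ⟩⟨ψ|) * Uᴴ) (x,y) (x',y), where |ψ⟩⟨ψ| is the matrix with entries ψ y * conj (ψ y'). Then there exists a family E : ι_E → Matrix ι ι ℂ of parity-definite matrices with ∑ k, (E k)ᴴ * E k = 1 such that φ ρ = ∑ k, E k * ρ * (E k)ᴴ for every parity-preserving ρ. -/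
open scoped Matrix Kronecker ComplexConjugate

namespace Stinespring

/-- The map `v ↦ v ⊗ ψ`, as a matrix. -/
def tensorVec (m : Type*) {n : Type*} [DecidableEq m] (ψ : n → ℂ) : Matrix (m × n) m ℂ :=
  Matrix.of fun p x => if p.1 = x then ψ p.2 else 0

/-- The `k`-th block of a matrix whose rows are indexed by a product. -/
def rowBlock {m n l : Type*} (W : Matrix (m × n) l ℂ) (k : n) : Matrix m l ℂ :=
  Matrix.of fun x x' => W (x, k) x'

lemma conjTranspose_tensorVec_mul_self {m n : Type*} [Fintype m] [Fintype n] [DecidableEq m]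
    (ψ : n → ℂ) (hψ : ∑ y, ‖ψ y‖ ^ 2 = 1) :
    (tensorVec m ψ)ᴴ * tensorVec m ψ = 1 := by
  have h : ∑ y, conj (ψ y) * ψ y = 1 := by
    simp_rw [Complex.conj_mul']
    exact_mod_cast hψ
  ext x x'
  simp only [Matrix.mul_apply, Matrix.conjTranspose_apply, tensorVec, Matrix.of_apply,
    Fintype.sum_prod_type, Matrix.one_apply]
  by_cases hx : x = x'
  · subst hx
    rw [Finset.sum_eq_single x] <;> simp_all
  · rw [if_neg hx]
    refine Finset.sum_eq_zero fun a _ => Finset.sum_eq_zero fun b _ => ?_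
    by_cases ha : a = x <;> simp_all

lemma tensorVec_mul_mul_conjTranspose {m n : Type*} [Fintype m] [DecidableEq m]
    (ψ : n → ℂ) (ρ : Matrix m m ℂ) :
    tensorVec m ψ * ρ * (tensorVec m ψ)ᴴ =
      ρ ⊗ₖ Matrix.of fun a b => ψ a * conj (ψ b) := by
  ext ⟨x, a⟩ ⟨x', b⟩
  simp [Matrix.mul_apply, tensorVec, apply_ite]
  ring

lemma kronecker_mul_tensorVec {m n : Type*} [Fintype m] [Fintype n] [DecidableEq m]
    [DecidableEq n] (s : m → ℂ) (t ψ : n → ℂ) (e : ℂ)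
    (h : ∀ b, t b * ψ b = e * ψ b) :
    (Matrix.diagonal s ⊗ₖ Matrix.diagonal t) * tensorVec m ψ =
      e • (tensorVec m ψ * Matrix.diagonal s) := by
  ext ⟨x, b⟩ x'
  rw [Matrix.diagonal_kronecker_diagonal, Matrix.diagonal_mul, Matrix.smul_apply,
    Matrix.mul_diagonal]
  by_cases hx : x = x'
  · simp only [tensorVec, Matrix.of_apply, ← hx, if_true, smul_eq_mul]
    linear_combination s x * h b
  · simp [tensorVec, hx]

lemma sum_conjTranspose_rowBlock_mul_self {m n l : Type*} [Fintype m] [Fintype n]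
    (W : Matrix (m × n) l ℂ) :
    ∑ k, (rowBlock W k)ᴴ * rowBlock W k = Wᴴ * W := by
  ext x x'
  simp only [Matrix.sum_apply, Matrix.mul_apply, Matrix.conjTranspose_apply, rowBlock,
    Matrix.of_apply, Fintype.sum_prod_type]
  exact Finset.sum_comm

lemma rowBlock_mul_mul_conjTranspose_apply {m n l : Type*} [Fintype l]
    (W : Matrix (m × n) l ℂ) (ρ : Matrix l l ℂ) (k : n) (x x' : m) :
    (rowBlock W k * ρ * (rowBlock W k)ᴴ) x x' = (W * ρ * Wᴴ) (x, k) (x', k) := by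
  simp [Matrix.mul_apply, rowBlock]

lemma diagonal_mul_rowBlock_mul_diagonal {m n : Type*} [Fintype m] [Fintype n]
    [DecidableEq m] [DecidableEq n] (s : m → ℂ) (t : n → ℂ) (e : ℂ)
    (hs : ∀ x, s x * s x = 1) (ht : ∀ k, t k * t k = 1) (W : Matrix (m × n) m ℂ)
    (hW : (Matrix.diagonal s ⊗ₖ Matrix.diagonal t) * W = e • (W * Matrix.diagonal s)) (k : n) :
    Matrix.diagonal s * rowBlock W k * Matrix.diagonal s = (t k * e) • rowBlock W k := by
  ext x x'
  have h := congrFun (congrFun hW (x, k)) x'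
  rw [Matrix.diagonal_kronecker_diagonal, Matrix.diagonal_mul, Matrix.smul_apply,
    Matrix.mul_diagonal, smul_eq_mul] at h
  simp only [Matrix.mul_diagonal, Matrix.diagonal_mul, rowBlock, Matrix.of_apply,
    Matrix.smul_apply, smul_eq_mul]
  linear_combination t k * s x' * h - s x * W (x, k) x' * s x' * ht k +
    t k * e * W (x, k) x' * hs x'

lemma sign_mul_self {γ δ : Type*} (z : γ ⊕ δ) :
    Sum.elim (fun _ => (1 : ℂ)) (fun _ => (-1 : ℂ)) z *
      Sum.elim (fun _ => (1 : ℂ)) (fun _ => (-1 : ℂ)) z = 1 := by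
  cases z <;> simp

end Stinespring

/-- Stinespring dilation to Kraus form: a parity-respecting unitary dilation with a
parity-eigenvector pure environment state yields an operator-sum representation with
parity-definite Kraus operators summing to the identity. -/
theorem stinespring_to_kraus
    {α β αE βE : Type*} [Fintype α] [Fintype β] [Fintype αE] [Fintype βE]
    [DecidableEq α] [DecidableEq β] [DecidableEq αE] [DecidableEq βE]
    (ψ : (αE ⊕ βE) → ℂ)
    (hψ_unit : ∑ y, ‖ψ y‖ ^ 2 = 1)
    (hψ_par : (parityMatrix αE βE).mulVec ψ = ψ ∨ (parityMatrix αE βE).mulVec ψ = -ψ)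
    (U : Matrix ((α ⊕ β) × (αE ⊕ βE)) ((α ⊕ β) × (αE ⊕ βE)) ℂ)
    (hU : U ∈ Matrix.unitaryGroup ((α ⊕ β) × (αE ⊕ βE)) ℂ)
    (hUS : U * (parityMatrix α β ⊗ₖ parityMatrix αE βE) =
      (parityMatrix α β ⊗ₖ parityMatrix αE βE) * U) :
    ∃ E : (αE ⊕ βE) → Matrix (α ⊕ β) (α ⊕ β) ℂ,
      (∀ k, parityMatrix α β * E k * parityMatrix α β = E k ∨
        parityMatrix α β * E k * parityMatrix α β = -(E k)) ∧
      (∑ k, (E k)ᴴ * E k) = 1 ∧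
      ∀ ρ : Matrix (α ⊕ β) (α ⊕ β) ℂ,
        parityMatrix α β * ρ * parityMatrix α β = ρ →
        ∀ x x', (∑ k, E k * ρ * (E k)ᴴ) x x' =
          ∑ y, (U * (ρ ⊗ₖ Matrix.of fun a b => ψ a * conj (ψ b)) * Uᴴ) (x, y) (x', y) := by
  obtain ⟨e, he, hψe⟩ : ∃ e : ℂ, (e = 1 ∨ e = -1) ∧
      ∀ b, Sum.elim (fun _ => (1 : ℂ)) (fun _ => (-1 : ℂ)) b * ψ b = e * ψ b := by
    rcases hψ_par with h | h
    · refine ⟨1, Or.inl rfl, fun b => ?_⟩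
      simpa [parityMatrix, Matrix.mulVec_diagonal] using congrFun h b
    · refine ⟨-1, Or.inr rfl, fun b => ?_⟩
      simpa [parityMatrix, Matrix.mulVec_diagonal] using congrFun h b
  set V := Stinespring.tensorVec (α ⊕ β) ψ with hV
  have hW : (parityMatrix α β ⊗ₖ parityMatrix αE βE) * (U * V) =
      e • (U * V * parityMatrix α β) := by
    rw [← Matrix.mul_assoc, ← hUS, Matrix.mul_assoc, parityMatrix, parityMatrix, hV,
      Stinespring.kronecker_mul_tensorVec _ _ ψ e hψe, Matrix.mul_smul, Matrix.mul_assoc]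
  refine ⟨Stinespring.rowBlock (U * V), fun k => ?_, ?_, fun ρ _ x x' => ?_⟩
  · have h := Stinespring.diagonal_mul_rowBlock_mul_diagonal _ _ e
      Stinespring.sign_mul_self Stinespring.sign_mul_self _ hW k
    rw [parityMatrix, h]
    rcases he with rfl | rfl <;> cases k <;> simp
  · rw [Stinespring.sum_conjTranspose_rowBlock_mul_self, Matrix.conjTranspose_mul,
      Matrix.mul_assoc, ← Matrix.mul_assoc Uᴴ, ← Matrix.star_eq_conjTranspose U,
      Matrix.mem_unitaryGroup_iff'.mp hU, Matrix.one_mul,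
      Stinespring.conjTranspose_tensorVec_mul_self ψ hψ_unit]
  · simp_rw [Matrix.sum_apply, Stinespring.rowBlock_mul_mul_conjTranspose_apply,
      ← Stinespring.tensorVec_mul_mul_conjTranspose, Matrix.conjTranspose_mul,
      Matrix.mul_assoc, hV]
end

section
/- Let ρ : Matrix (ι₁ × ι₂) (ι₁ × ι₂) ℂ be a positive semidefinite matrix of trace 1 commuting with the Kronecker product S₁ ⊗ S₂, and let ρ_A : Matrix ι₁ ι₁ ℂ and ρ_B : Matrix ι₂ ι₂ ℂ be its partial traces, ρ_A x x' = ∑ y, ρ (x,y) (x',y) and ρ_B y y' = ∑ x, ρ (x,y) (x,y'). Then the following are equivalent: (1) for every Hermitian O_A : Matrix ι₁ ι₁ ℂ and every Hermitian O_B : Matrix ι₂ ι₂ ℂ, the trace of ρ * (O_A ⊗ O_B) equals (trace of ρ_A * O_A) * (trace of ρ_B * O_B); (2) ρ = ρ_A ⊗ ρ_B, i.e. ρ (x,y) (x',y') = ρ_A x x' * ρ_B y y' for all entries. -/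
open scoped Matrix Kronecker ComplexOrder

/-- Linear maps on a complex star module agree once they agree on self-adjoint elements. -/
theorem LinearMap.ext_of_isSelfAdjoint {A M : Type*} [AddCommGroup A] [Module ℂ A]
    [StarAddMonoid A] [StarModule ℂ A] [AddCommMonoid M] [Module ℂ M] {f g : A →ₗ[ℂ] M}
    (h : ∀ a, IsSelfAdjoint a → f a = g a) : f = g := by
  ext a
  rw [← realPart_add_I_smul_imaginaryPart a]
  simp only [map_add, map_smul, h _ (realPart a).2, h _ (imaginaryPart a).2]

namespace Matrix

variable {m n : Type*} [Fintype m] [Fintype n]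

/-- The bilinear form `(A, B) ↦ tr (ρ (A ⊗ B))`. -/
noncomputable def traceMulKronecker (ρ : Matrix (m × n) (m × n) ℂ) :
    Matrix m m ℂ →ₗ[ℂ] Matrix n n ℂ →ₗ[ℂ] ℂ :=
  (kroneckerBilinear (R := ℂ) (α := ℂ)).compr₂
    (traceLinearMap (m × n) ℂ ℂ ∘ₗ LinearMap.mulLeft ℂ ρ)

theorem traceMulKronecker_apply (ρ : Matrix (m × n) (m × n) ℂ) (A : Matrix m m ℂ)
    (B : Matrix n n ℂ) : traceMulKronecker ρ A B = (ρ * (A ⊗ₖ B)).trace :=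
  rfl

theorem traceMulKronecker_single [DecidableEq m] [DecidableEq n]
    (ρ : Matrix (m × n) (m × n) ℂ) (x x' : m) (y y' : n) :
    traceMulKronecker ρ (single x' x 1) (single y' y 1) = ρ (x, y) (x', y') := by
  simp [traceMulKronecker_apply, single_kronecker_single, trace_mul_single]

theorem ext_of_trace_mul_kronecker [DecidableEq m] [DecidableEq n]
    {ρ σ : Matrix (m × n) (m × n) ℂ}
    (h : ∀ (A : Matrix m m ℂ) (B : Matrix n n ℂ), A.IsHermitian → B.IsHermitian →
      (ρ * (A ⊗ₖ B)).trace = (σ * (A ⊗ₖ B)).trace) : ρ = σ := by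
  have key : traceMulKronecker ρ = traceMulKronecker σ :=
    LinearMap.ext_of_isSelfAdjoint fun A hA =>
      LinearMap.ext_of_isSelfAdjoint fun B hB => h A B hA hB
  ext ⟨x, y⟩ ⟨x', y'⟩
  rw [← traceMulKronecker_single ρ, key, traceMulKronecker_single]

theorem trace_kronecker_mul_kronecker (A C : Matrix m m ℂ) (B D : Matrix n n ℂ) :
    ((A ⊗ₖ B) * (C ⊗ₖ D)).trace = (A * C).trace * (B * D).trace := by
  rw [← mul_kronecker_mul, trace_kronecker]

end Matrix

/-- A bipartite fermionic state obeying the parity super-selection rule is uncorrelated with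
respect to all (not necessarily parity-respecting) local Hermitian observables iff it is the
product of its partial traces. -/
theorem uncorrelated_iff_product_state
    {α₁ β₁ α₂ β₂ : Type*} [Fintype α₁] [Fintype β₁] [Fintype α₂] [Fintype β₂]
    [DecidableEq α₁] [DecidableEq β₁] [DecidableEq α₂] [DecidableEq β₂]
    (ρ : Matrix ((α₁ ⊕ β₁) × (α₂ ⊕ β₂)) ((α₁ ⊕ β₁) × (α₂ ⊕ β₂)) ℂ)
    (hpsd : ρ.PosSemidef) (htr : ρ.trace = 1)
    (hcomm : ρ * (parityMatrix α₁ β₁ ⊗ₖ parityMatrix α₂ β₂) =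
      (parityMatrix α₁ β₁ ⊗ₖ parityMatrix α₂ β₂) * ρ)
    (ρA : Matrix (α₁ ⊕ β₁) (α₁ ⊕ β₁) ℂ)
    (hρA : ∀ x x', ρA x x' = ∑ y, ρ (x, y) (x', y))
    (ρB : Matrix (α₂ ⊕ β₂) (α₂ ⊕ β₂) ℂ)
    (hρB : ∀ y y', ρB y y' = ∑ x, ρ (x, y) (x, y')) :
    (∀ (OA : Matrix (α₁ ⊕ β₁) (α₁ ⊕ β₁) ℂ) (OB : Matrix (α₂ ⊕ β₂) (α₂ ⊕ β₂) ℂ),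
      OAᴴ = OA → OBᴴ = OB →
      (ρ * (OA ⊗ₖ OB)).trace = (ρA * OA).trace * (ρB * OB).trace) ↔
    (∀ x y x' y', ρ (x, y) (x', y') = ρA x x' * ρB y y') := by
  constructor
  · intro h x y x' y'
    have hρ : ρ = ρA ⊗ₖ ρB := Matrix.ext_of_trace_mul_kronecker fun OA OB hA hB => by
      rw [h OA OB hA hB, Matrix.trace_kronecker_mul_kronecker]
    rw [hρ, Matrix.kronecker_apply]
  · intro h OA OB _ _
    have hρ : ρ = ρA ⊗ₖ ρB := by
      ext ⟨x, y⟩ ⟨x', y'⟩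
      exact h x y x' y'
    rw [hρ, Matrix.trace_kronecker_mul_kronecker]
end

section
/- Let ρ : Matrix (ι₁ × ι₂) (ι₁ × ι₂) ℂ be a positive semidefinite matrix of trace 1 commuting with the Kronecker product S₁ ⊗ S₂. Then the matrix σ : Matrix ι₁ ι₁ ℂ defined by σ x x' = ∑ y, ρ (x,y) (x',y) is Hermitian, positive semidefinite, has trace 1, is parity-preserving (S₁ * σ * S₁ = σ), and satisfies the consistency condition: trace of ρ * (O ⊗ 1) = trace of σ * O for every Hermitian parity-preserving O : Matrix ι₁ ι₁ ℂ. Moreover σ is the unique Hermitian parity-preserving matrix satisfying this consistency condition: if τ : Matrix ι₁ ι₁ ℂ is Hermitian, parity-preserving, and satisfies trace of ρ * (O ⊗ 1) = trace of τ * O for every Hermitian parity-preserving O, then τ = σ. -/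
open scoped Matrix Kronecker ComplexOrder

/-- The entrywise partial trace over the second tensor factor. -/
def entrywisePartialTrace {m n R : Type*} [Fintype n] [AddCommMonoid R]
    (ρ : Matrix (m × n) (m × n) R) : Matrix m m R :=
  Matrix.of fun x x' => ∑ y, ρ (x, y) (x', y)

theorem entrywisePartialTrace_eq_sum_submatrix {m n R : Type*} [Fintype n] [AddCommMonoid R]
    (ρ : Matrix (m × n) (m × n) R) :
    entrywisePartialTrace ρ = ∑ y, ρ.submatrix (fun x => (x, y)) (fun x => (x, y)) := by
  ext x x'
  simp [entrywisePartialTrace, Matrix.sum_apply]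

theorem posSemidef_entrywisePartialTrace {m n : Type*} [Fintype n]
    {ρ : Matrix (m × n) (m × n) ℂ} (hρ : ρ.PosSemidef) :
    (entrywisePartialTrace ρ).PosSemidef := by
  rw [entrywisePartialTrace_eq_sum_submatrix]
  exact Matrix.posSemidef_sum _ fun y _ => hρ.submatrix _

theorem trace_mul_kronecker_one {m n R : Type*} [Fintype m] [Fintype n] [DecidableEq n]
    [CommSemiring R] (ρ : Matrix (m × n) (m × n) R) (O : Matrix m m R) :
    (ρ * (O ⊗ₖ (1 : Matrix n n R))).trace = (entrywisePartialTrace ρ * O).trace := by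
  simp only [Matrix.trace, Matrix.diag_apply, Matrix.mul_apply, Matrix.kroneckerMap_apply,
    Fintype.sum_prod_type, Matrix.one_apply, mul_ite, mul_one, mul_zero,
    Finset.sum_ite_eq', Finset.mem_univ, if_true, entrywisePartialTrace, Matrix.of_apply,
    Finset.sum_mul]
  exact Finset.sum_congr rfl fun x _ => Finset.sum_comm

theorem trace_entrywisePartialTrace {m n R : Type*} [Fintype m] [Fintype n]
    [AddCommMonoid R] (ρ : Matrix (m × n) (m × n) R) :
    (entrywisePartialTrace ρ).trace = ρ.trace := by
  simp [Matrix.trace, entrywisePartialTrace, Fintype.sum_prod_type]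

/-- If `ρ` commutes with a tensor product of diagonal involutions, then its partial trace is
invariant under conjugation by the first of them. -/
theorem diagonal_mul_entrywisePartialTrace_mul_diagonal {m n R : Type*} [Fintype m] [Fintype n]
    [DecidableEq m] [DecidableEq n] [CommRing R] {s : m → R} {t : n → R}
    (hs : ∀ x, s x * s x = 1) (ht : ∀ y, t y * t y = 1) {ρ : Matrix (m × n) (m × n) R}
    (hcomm : ρ * (Matrix.diagonal s ⊗ₖ Matrix.diagonal t) =
      (Matrix.diagonal s ⊗ₖ Matrix.diagonal t) * ρ) :
    Matrix.diagonal s * entrywisePartialTrace ρ * Matrix.diagonal s =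
      entrywisePartialTrace ρ := by
  ext x x'
  simp only [Matrix.mul_diagonal, Matrix.diagonal_mul, entrywisePartialTrace, Matrix.of_apply,
    Finset.mul_sum, Finset.sum_mul]
  refine Finset.sum_congr rfl fun y _ => ?_
  have h := congrFun (congrFun hcomm (x, y)) (x', y)
  rw [Matrix.diagonal_kronecker_diagonal, Matrix.mul_diagonal, Matrix.diagonal_mul] at h
  linear_combination (-(t y * s x')) * h +
    ((s x' - s x) * s x' * ρ (x, y) (x', y)) * ht y + ρ (x, y) (x', y) * hs x'

theorem parity_sign_mul_self {α β : Type*} (x : α ⊕ β) :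
    Sum.elim (fun _ => (1 : ℂ)) (fun _ => (-1 : ℂ)) x *
      Sum.elim (fun _ => (1 : ℂ)) (fun _ => (-1 : ℂ)) x = 1 := by
  cases x <;> simp

/-- Existence and uniqueness of the fermionic partial trace characterized by the physical
consistency conditions: the entrywise partial trace `σ` of a parity-respecting density matrix
is a Hermitian, positive semidefinite, trace-one, parity-preserving matrix reproducing all
expectation values of local parity-respecting Hermitian observables, and it is the unique
Hermitian parity-preserving matrix doing so. -/
theorem partial_trace_exists_unique
    {α₁ β₁ α₂ β₂ : Type*} [Fintype α₁] [Fintype β₁] [Fintype α₂] [Fintype β₂]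
    [DecidableEq α₁] [DecidableEq β₁] [DecidableEq α₂] [DecidableEq β₂]
    (ρ : Matrix ((α₁ ⊕ β₁) × (α₂ ⊕ β₂)) ((α₁ ⊕ β₁) × (α₂ ⊕ β₂)) ℂ)
    (hpsd : ρ.PosSemidef) (htr : ρ.trace = 1)
    (hcomm : ρ * (parityMatrix α₁ β₁ ⊗ₖ parityMatrix α₂ β₂) =
      (parityMatrix α₁ β₁ ⊗ₖ parityMatrix α₂ β₂) * ρ)
    (σ : Matrix (α₁ ⊕ β₁) (α₁ ⊕ β₁) ℂ)
    (hσ : ∀ x x', σ x x' = ∑ y, ρ (x, y) (x', y)) :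
    σᴴ = σ ∧ σ.PosSemidef ∧ σ.trace = 1 ∧
      parityMatrix α₁ β₁ * σ * parityMatrix α₁ β₁ = σ ∧
      (∀ O : Matrix (α₁ ⊕ β₁) (α₁ ⊕ β₁) ℂ, Oᴴ = O →
        parityMatrix α₁ β₁ * O * parityMatrix α₁ β₁ = O →
        (ρ * (O ⊗ₖ (1 : Matrix (α₂ ⊕ β₂) (α₂ ⊕ β₂) ℂ))).trace = (σ * O).trace) ∧
      (∀ τ : Matrix (α₁ ⊕ β₁) (α₁ ⊕ β₁) ℂ, τᴴ = τ →
        parityMatrix α₁ β₁ * τ * parityMatrix α₁ β₁ = τ →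
        (∀ O : Matrix (α₁ ⊕ β₁) (α₁ ⊕ β₁) ℂ, Oᴴ = O →
          parityMatrix α₁ β₁ * O * parityMatrix α₁ β₁ = O →
          (ρ * (O ⊗ₖ (1 : Matrix (α₂ ⊕ β₂) (α₂ ⊕ β₂) ℂ))).trace = (τ * O).trace) →
        τ = σ) := by
  obtain rfl : σ = entrywisePartialTrace ρ := Matrix.ext hσ
  have hσpsd := posSemidef_entrywisePartialTrace hpsd
  have hσparity : parityMatrix α₁ β₁ * entrywisePartialTrace ρ * parityMatrix α₁ β₁ =
      entrywisePartialTrace ρ :=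
    diagonal_mul_entrywisePartialTrace_mul_diagonal parity_sign_mul_self parity_sign_mul_self
      hcomm
  refine ⟨hσpsd.isHermitian, hσpsd, (trace_entrywisePartialTrace ρ).trans htr, hσparity,
    fun O _ _ => trace_mul_kronecker_one ρ O, fun τ hτ hτparity hτtrace => ?_⟩
  have hherm : (τ - entrywisePartialTrace ρ)ᴴ = τ - entrywisePartialTrace ρ := by
    rw [Matrix.conjTranspose_sub, hτ, hσpsd.isHermitian]
  have htrace := hτtrace (τ - entrywisePartialTrace ρ) hherm
    (by rw [mul_sub, sub_mul, hτparity, hσparity])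
  rw [trace_mul_kronecker_one] at htrace
  rw [← sub_eq_zero, ← Matrix.trace_conjTranspose_mul_self_eq_zero_iff, hherm, sub_mul,
    Matrix.trace_sub, htrace, sub_self]
end
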